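/- arXiv:2006.11531 — 2 statements merged into one kernel-verified Lean document; each statement's English description precedes it below -/
import Mathlib

section
/- Let T ∈ (0,∞) and μ ∈ (1/2,1]. If u ∈ L²_μ((0,T); L²(ℝ^{2n})) and its distributional transport derivative ∂_t u + v·∇_x u also belongs to L²_μ((0,T); L²(ℝ^{2n})), then u has a representative which is continuous from [0,T] to L²(ℝ^{2n}), and there is a constant C = C(T,μ) > 0, independent of u, such that sup_{t∈[0,T]} ‖u(t)‖_{L²(ℝ^{2n})} ≤ C (‖u‖_{L²_μ((0,T);L²)} + ‖∂_t u + v·∇_x u‖_{L²_μ((0,T);L²)}). -/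
open MeasureTheory Set Filter
open scoped ENNReal

noncomputable section

/-- `ℝⁿ` with the Euclidean norm. -/
abbrev En (n : ℕ) : Type := EuclideanSpace ℝ (Fin n)

/-- `h = ∂_t u + v·∇ₓ u` in the sense of distributions on `(0,T) × ℝ^{2n}`,
where a point of `ℝ^{2n}` is written `q = (x, v)`. -/
def IsTransportDeriv (n : ℕ) (T : ℝ) (u h : ℝ → En n × En n → ℂ) : Prop :=
  ∀ φ : ℝ × (En n × En n) → ℝ, ContDiff ℝ ((⊤ : ℕ∞) : WithTop ℕ∞) φ → HasCompactSupport φ →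
    (∀ p : ℝ × (En n × En n), p.1 ∉ Ioo 0 T → φ p = 0) →
    -(∫ t in Ioo 0 T, ∫ q : En n × En n,
        u t q * (fderiv ℝ φ (t, q) ((1 : ℝ), (q.2, (0 : En n))) : ℂ))
      = ∫ t in Ioo 0 T, ∫ q : En n × En n, h t q * (φ (t, q) : ℂ)

/-- `w' = ∂_t w` in the sense of distributions on `(0,T) × ℝ^{2n}`. -/
def IsTimeDeriv (n : ℕ) (T : ℝ) (w w' : ℝ → En n × En n → ℂ) : Prop :=
  ∀ φ : ℝ × (En n × En n) → ℝ, ContDiff ℝ ((⊤ : ℕ∞) : WithTop ℕ∞) φ → HasCompactSupport φ →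
    (∀ p : ℝ × (En n × En n), p.1 ∉ Ioo 0 T → φ p = 0) →
    -(∫ t in Ioo 0 T, ∫ q : En n × En n,
        w t q * (fderiv ℝ φ (t, q) ((1 : ℝ), (0 : En n × En n)) : ℂ))
      = ∫ t in Ioo 0 T, ∫ q : En n × En n, w' t q * (φ (t, q) : ℂ)

/-- Squared norm of `L²_μ((0,T); L²(ℝ^{2n}))`. -/
def L2mu (n : ℕ) (T μ : ℝ) (u : ℝ → En n × En n → ℂ) : ℝ≥0∞ :=
  ∫⁻ t in Ioo 0 T, ∫⁻ q : En n × En n, ENNReal.ofReal (t ^ (2 - 2*μ) * ‖u t q‖ ^ 2)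

/-- Smooth functions with compact support in the open interval `(0,T)`. -/
structure IsTestOn (T : ℝ) (η : ℝ → ℝ) : Prop where
  contDiff : ContDiff ℝ ((⊤ : ℕ∞) : WithTop ℕ∞) η
  hasCompactSupport : HasCompactSupport η
  tsupport_subset : tsupport η ⊆ Ioo 0 T

theorem IsTestOn.eq_zero {T : ℝ} {η : ℝ → ℝ} (hη : IsTestOn T η) {t : ℝ} (ht : t ∉ Ioo 0 T) :
    η t = 0 :=
  image_eq_zero_of_notMem_tsupport fun h => ht (hη.tsupport_subset h)

theorem IsTestOn.deriv {T : ℝ} {η : ℝ → ℝ} (hη : IsTestOn T η) : IsTestOn T (deriv η) where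
  contDiff := (contDiff_infty_iff_deriv.1 hη.contDiff).2
  hasCompactSupport := hη.hasCompactSupport.deriv
  tsupport_subset := (tsupport_deriv_subset (𝕜 := ℝ)).trans hη.tsupport_subset

theorem IsTestOn.exists_bound {T : ℝ} {η : ℝ → ℝ} (hη : IsTestOn T η) : ∃ C, ∀ t, ‖η t‖ ≤ C :=
  hη.hasCompactSupport.exists_bound_of_continuous hη.contDiff.continuous

theorem IsTestOn.exists_Icc {T : ℝ} (hT : 0 < T) {η : ℝ → ℝ} (hη : IsTestOn T η) :
    ∃ a b, 0 < a ∧ b < T ∧ ∀ t, t ∉ Icc a b → η t = 0 := by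
  by_cases hne : (tsupport η).Nonempty
  · obtain ⟨a, ha⟩ := hη.hasCompactSupport.isCompact.exists_isLeast hne
    obtain ⟨b, hb⟩ := hη.hasCompactSupport.isCompact.exists_isGreatest hne
    exact ⟨a, b, (hη.tsupport_subset ha.1).1, (hη.tsupport_subset hb.1).2, fun t ht =>
      image_eq_zero_of_notMem_tsupport fun h => ht ⟨ha.2 h, hb.2 h⟩⟩
  · exact ⟨T, 0, hT, hT, fun t _ =>
      image_eq_zero_of_notMem_tsupport fun h => hne ⟨t, h⟩⟩

theorem IsTestOn.exists_primitive {T : ℝ} (hT : 0 < T) {ζ : ℝ → ℝ} (hζ : IsTestOn T ζ)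
    (hInt : ∫ t in Ioo 0 T, ζ t = 0) : ∃ η, IsTestOn T η ∧ _root_.deriv η = ζ := by
  obtain ⟨a, b, ha, hb, hab⟩ := hζ.exists_Icc hT
  have hc : Continuous ζ := hζ.contDiff.continuous
  set η : ℝ → ℝ := fun t => ∫ s in (0 : ℝ)..t, ζ s with hη
  have hder : ∀ t, HasDerivAt η (ζ t) t := fun t =>
    intervalIntegral.integral_hasDerivAt_right (hc.intervalIntegrable _ _)
      hc.aestronglyMeasurable.stronglyMeasurableAtFilter hc.continuousAt
  have hd : _root_.deriv η = ζ := funext fun t => (hder t).deriv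
  have hT0 : η T = 0 := by
    rw [hη]
    simp only
    rw [intervalIntegral.integral_of_le hT.le, integral_Ioc_eq_integral_Ioo, hInt]
  have hsupp : Function.support η ⊆ Icc a b := by
    intro t ht
    by_contra hn
    apply ht
    rcases not_and_or.1 hn with h | h
    · refine intervalIntegral.integral_zero_ae (Eventually.of_forall fun s hs => hab s fun hs' => ?_)
      have h0 := hs'.1
      push Not at h
      have : s ≤ max 0 t := hs.2
      rcases le_max_iff.1 this with h1 | h1 <;> linarith
    · push Not at h
      have h2 : η T = η t + ∫ s in t..T, ζ s :=
        (intervalIntegral.integral_add_adjacent_intervals (hc.intervalIntegrable _ _)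
          (hc.intervalIntegrable _ _)).symm
      have h3 : ∫ s in t..T, ζ s = 0 := by
        refine intervalIntegral.integral_zero_ae
          (Eventually.of_forall fun s hs => hab s fun hs' => ?_)
        have h1 : min t T < s := hs.1
        have h0 := hs'.2
        rcases min_lt_iff.1 h1 with h1 | h1 <;> linarith
      rw [h3, hT0, add_zero] at h2
      exact h2.symm
  have hcl : tsupport η ⊆ Icc a b := closure_minimal hsupp isClosed_Icc
  refine ⟨η, ⟨?_, ?_, ?_⟩, hd⟩
  · rw [contDiff_infty_iff_deriv, hd]
    exact ⟨fun t => (hder t).differentiableAt, hζ.contDiff⟩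
  · exact HasCompactSupport.of_support_subset_isCompact isCompact_Icc hsupp
  · exact hcl.trans fun t ht => ⟨ha.trans_le ht.1, ht.2.trans_lt hb⟩

theorem exists_isTestOn_integral_eq_one {T : ℝ} (hT : 0 < T) :
    ∃ η, IsTestOn T η ∧ ∫ t in Ioo 0 T, η t = 1 := by
  let f : ContDiffBump (T / 2) := ⟨T / 8, T / 4, by positivity, by linarith⟩
  have h : IsTestOn T (f.normed volume) := by
    refine ⟨f.contDiff_normed, f.hasCompactSupport_normed, ?_⟩
    rw [f.tsupport_normed_eq, Real.closedBall_eq_Icc]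
    intro t ht
    have h1 : T / 2 - T / 4 ≤ t := ht.1
    have h2 : t ≤ T / 2 + T / 4 := ht.2
    constructor <;> linarith
  refine ⟨_, h, ?_⟩
  rw [setIntegral_eq_integral_of_forall_compl_eq_zero fun t ht => h.eq_zero ht]
  exact f.integral_normed

theorem IsTestOn.sub_const_mul {T : ℝ} {η ζ : ℝ → ℝ} (hη : IsTestOn T η) (hζ : IsTestOn T ζ)
    (c : ℝ) : IsTestOn T (fun t => η t - c * ζ t) where
  contDiff := hη.contDiff.sub (contDiff_const.mul hζ.contDiff)
  hasCompactSupport := hη.hasCompactSupport.sub hζ.hasCompactSupport.mul_left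
  tsupport_subset := by
    refine (tsupport_sub η (fun t => c * ζ t)).trans (union_subset hη.tsupport_subset ?_)
    exact (tsupport_mul_subset_right (f := fun _ => c) (g := ζ)).trans hζ.tsupport_subset

/-- Integration by parts against the primitive of an integrable function. -/
theorem integral_deriv_mul_primitive {T : ℝ} {η : ℝ → ℝ} (hη : IsTestOn T η) {g : ℝ → ℂ}
    (hg : IntegrableOn g (Ioo 0 T)) :
    ∫ t in Ioo 0 T, ((deriv η t : ℝ) : ℂ) * ∫ s in Ioo 0 t, g s = -∫ t in Ioo 0 T, (η t : ℂ) * g t := by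
  have hc : Continuous (deriv η) := hη.deriv.contDiff.continuous
  have hd : Integrable (fun t => ((deriv η t : ℝ) : ℂ)) (volume.restrict (Ioo 0 T)) :=
    ((hc.integrable_of_hasCompactSupport hη.deriv.hasCompactSupport).ofReal).integrableOn
  set F : ℝ → ℝ → ℂ := fun t s => {p : ℝ × ℝ | p.2 < p.1}.indicator
    (fun p => ((deriv η p.1 : ℝ) : ℂ) * g p.2) (t, s) with hF
  have hFi : Integrable (Function.uncurry F)
      ((volume.restrict (Ioo 0 T)).prod (volume.restrict (Ioo 0 T))) :=
    (hd.mul_prod hg).indicator (measurableSet_lt measurable_snd measurable_fst)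
  have hsw := integral_integral_swap hFi
  have h1 : ∀ t ∈ Ioo 0 T, ∫ s in Ioo 0 T, F t s = ((deriv η t : ℝ) : ℂ) * ∫ s in Ioo 0 t, g s := by
    intro t ht
    rw [← integral_const_mul]
    have : ∀ s, F t s = (Iio t).indicator (fun s => ((deriv η t : ℝ) : ℂ) * g s) s := fun s => by
      simp [hF, indicator]
    simp_rw [this]
    rw [setIntegral_indicator measurableSet_Iio]
    congr 2
    ext s
    simp only [mem_inter_iff, mem_Ioo, mem_Iio]
    constructor
    · rintro ⟨⟨a, b⟩, c⟩; exact ⟨a, c⟩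
    · rintro ⟨a, c⟩; exact ⟨⟨a, c.trans ht.2⟩, c⟩
  have h2 : ∀ s ∈ Ioo 0 T, ∫ t in Ioo 0 T, F t s = -((η s : ℂ) * g s) := by
    intro s hs
    have : ∀ t, F t s = (Ioi s).indicator (fun t => ((deriv η t : ℝ) : ℂ) * g s) t := fun t => by
      simp [hF, indicator]
    simp_rw [this]
    rw [setIntegral_indicator measurableSet_Ioi]
    have hset : Ioo 0 T ∩ Ioi s = Ioo s T := by
      ext t
      simp only [mem_inter_iff, mem_Ioo, mem_Ioi]
      constructor
      · rintro ⟨⟨a, b⟩, c⟩; exact ⟨c, b⟩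
      · rintro ⟨a, c⟩; exact ⟨⟨hs.1.trans a, c⟩, a⟩
    rw [hset, integral_mul_const, integral_complex_ofReal, ← integral_Ioc_eq_integral_Ioo,
      ← intervalIntegral.integral_of_le hs.2.le,
      intervalIntegral.integral_deriv_eq_sub
        (fun t _ => (contDiff_infty_iff_deriv.1 hη.contDiff).1 t) (hc.intervalIntegrable _ _),
      hη.eq_zero (t := T) (by simp)]
    simp
  rw [setIntegral_congr_fun measurableSet_Ioo h1, setIntegral_congr_fun measurableSet_Ioo h2,
    integral_neg] at hsw
  exact hsw

/-- An integrable function on a product whose integral over every rectangle vanishes is zero. -/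
theorem ae_eq_zero_of_forall_setIntegral_prod_eq_zero {α β : Type*} [MeasurableSpace α]
    [MeasurableSpace β] {m : Measure (α × β)} {F : α × β → ℂ} (hF : Integrable F m)
    (h : ∀ A B, MeasurableSet A → MeasurableSet B → ∫ p in A ×ˢ B, F p ∂m = 0) : F =ᵐ[m] 0 := by
  refine hF.ae_eq_zero_of_forall_setIntegral_eq_zero fun s hs hfin => ?_
  clear hfin
  induction s, hs using MeasurableSpace.induction_on_inter generateFrom_prod.symm isPiSystem_prod
    with
  | empty => simp
  | basic t ht =>
    obtain ⟨A, hA, B, hB, rfl⟩ := ht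
    exact h A B hA hB
  | compl t htm ih =>
    have h0 := h univ univ .univ .univ
    rw [univ_prod_univ, setIntegral_univ, ← integral_add_compl htm hF] at h0
    simpa [ih] using h0
  | iUnion f hd hm ih =>
    rw [integral_iUnion hm hd hF.integrableOn]
    simp [ih]

section Parametric

variable {X : Type*} [MeasurableSpace X] {ν : Measure X}

theorem ae_eq_zero_of_forall_isTestOn {T : ℝ} [SigmaFinite ν] {F : ℝ × X → ℂ} {B : Set X}
    (hF : Integrable F ((volume.restrict (Ioo 0 T)).prod (ν.restrict B)))
    (h : ∀ ζ, IsTestOn T ζ → ∀ᵐ q ∂ν, ∫ t in Ioo 0 T, (ζ t : ℂ) * F (t, q) = 0) :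
    F =ᵐ[(volume.restrict (Ioo 0 T)).prod (ν.restrict B)] 0 := by
  refine ae_eq_zero_of_forall_setIntegral_prod_eq_zero hF fun A B' hA hB' => ?_
  have hF' : Integrable F ((volume.restrict (Ioo 0 T)).prod ((ν.restrict B).restrict B')) := by
    have := hF.integrableOn (s := univ ×ˢ B')
    rwa [IntegrableOn, ← Measure.prod_restrict, Measure.restrict_univ] at this
  have hf : ∀ᵐ t, t ∈ Ioo 0 T → ∫ q in B', F (t, q) ∂(ν.restrict B) = 0 := by
    refine isOpen_Ioo.ae_eq_zero_of_integral_contDiff_smul_eq_zero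
      (IntegrableOn.locallyIntegrableOn hF'.integral_prod_left) fun ζ h1 h2 h3 => ?_
    have hζ : IsTestOn T ζ := ⟨h1, h2, h3⟩
    obtain ⟨C, hC⟩ := hζ.exists_bound
    rw [← setIntegral_eq_integral_of_forall_compl_eq_zero (s := Ioo 0 T)
      fun t ht => by rw [hζ.eq_zero ht, zero_smul]]
    have hi : Integrable (fun p : ℝ × X => (ζ p.1 : ℂ) * F p)
        ((volume.restrict (Ioo 0 T)).prod ((ν.restrict B).restrict B')) := by
      refine hF'.bdd_mul (c := C) ?_ (Eventually.of_forall fun p => by simpa using hC p.1)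
      exact (Complex.measurable_ofReal.comp
        (hζ.contDiff.continuous.measurable.comp measurable_fst)).aestronglyMeasurable
    have hsw := integral_integral_swap (f := fun t q => (ζ t : ℂ) * F (t, q)) hi
    simp_rw [integral_const_mul] at hsw
    simp_rw [Complex.real_smul]
    rw [hsw]
    refine integral_eq_zero_of_ae ?_
    exact ae_restrict_of_ae (ae_restrict_of_ae (h ζ hζ))
  rw [setIntegral_prod _ hF.integrableOn]
  refine integral_eq_zero_of_ae (ae_restrict_of_ae ?_)
  rwa [← ae_restrict_iff' measurableSet_Ioo] at hf

theorem measurable_primitive [SFinite ν] {g : ℝ → X → ℂ} (hg : Measurable fun p : ℝ × X => g p.1 p.2) :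
    Measurable fun p : ℝ × X => ∫ s in Ioo 0 p.1, g s p.2 := by
  have : ∀ p : ℝ × X, ∫ s in Ioo 0 p.1, g s p.2
      = ∫ s, {z : (ℝ × X) × ℝ | 0 < z.2 ∧ z.2 < z.1.1}.indicator (fun z => g z.2 z.1.2) (p, s) := by
    intro p
    rw [← integral_indicator measurableSet_Ioo]
    rfl
  simp_rw [this]
  refine StronglyMeasurable.measurable (StronglyMeasurable.integral_prod_right' ?_)
  refine Measurable.stronglyMeasurable (Measurable.indicator ?_ ?_)
  · exact hg.comp (measurable_snd.prodMk (measurable_snd.comp measurable_fst))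
  · exact (measurableSet_lt measurable_const measurable_snd).inter
      (measurableSet_lt measurable_snd (measurable_fst.comp measurable_fst))

/-- Integrability over `(0,T) × B` for every set `B` of finite measure. -/
def IntegrableOnStrips (T : ℝ) (ν : Measure X) (F : ℝ → X → ℂ) : Prop :=
  ∀ B, MeasurableSet B → ν B < ⊤ →
    Integrable (fun p : ℝ × X => F p.1 p.2) ((volume.restrict (Ioo 0 T)).prod (ν.restrict B))

theorem IntegrableOnStrips.ae_integrable {T : ℝ} [SigmaFinite ν] {F : ℝ → X → ℂ}
    (hF : IntegrableOnStrips T ν F) : ∀ᵐ q ∂ν, IntegrableOn (fun t => F t q) (Ioo 0 T) :=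
  ae_of_forall_measure_lt_top_ae_restrict _ fun B hB hB' => (hF B hB hB').prod_left_ae

theorem IntegrableOnStrips.primitive {T : ℝ} [SigmaFinite ν] {g : ℝ → X → ℂ}
    (hgm : Measurable fun p : ℝ × X => g p.1 p.2) (hg : IntegrableOnStrips T ν g) :
    IntegrableOnStrips T ν fun t q => ∫ s in Ioo 0 t, g s q := by
  intro B hB hB'
  have hb : Integrable (fun p : ℝ × X => ∫ s in Ioo 0 T, ‖g s p.2‖)
      ((volume.restrict (Ioo 0 T)).prod (ν.restrict B)) :=
    (hg B hB hB').integral_norm_prod_right.comp_snd _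
  refine hb.mono' (measurable_primitive (ν := ν) hgm).aestronglyMeasurable ?_
  have hms : MeasurableSet {p : ℝ × X | ‖∫ s in Ioo 0 p.1, g s p.2‖ ≤ ∫ s in Ioo 0 T, ‖g s p.2‖} := by
    refine measurableSet_le (measurable_primitive (ν := ν) hgm).norm ?_
    have h1 : StronglyMeasurable fun q : X => ∫ s in Ioo 0 T, ‖g s q‖ :=
      StronglyMeasurable.integral_prod_left' (f := fun p : ℝ × X => ‖g p.1 p.2‖)
        hgm.norm.stronglyMeasurable
    exact h1.measurable.comp measurable_snd
  rw [Measure.ae_prod_iff_ae_ae hms]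
  refine (ae_restrict_iff' measurableSet_Ioo).2 (Eventually.of_forall fun t ht => ?_)
  filter_upwards [ae_restrict_of_ae hg.ae_integrable] with q hq
  exact (norm_integral_le_integral_norm _).trans
    (setIntegral_mono_set hq.norm (Eventually.of_forall fun _ => norm_nonneg _)
      (Ioo_subset_Ioo_right ht.2.le).eventuallyLE)

/-- A function whose weak derivative in the first variable is `g` is, up to a function of the
second variable, the primitive of `g`. -/
theorem exists_ae_eq_add_primitive {T : ℝ} (hT : 0 < T) [SigmaFinite ν] {w g : ℝ → X → ℂ}
    (hwm : Measurable fun p : ℝ × X => w p.1 p.2) (hgm : Measurable fun p : ℝ × X => g p.1 p.2)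
    (hw : IntegrableOnStrips T ν w) (hg : IntegrableOnStrips T ν g)
    (h : ∀ η, IsTestOn T η →
      ∀ᵐ q ∂ν, ∫ t in Ioo 0 T, (((deriv η t : ℝ) : ℂ) * w t q + (η t : ℂ) * g t q) = 0) :
    ∃ c : X → ℂ, Measurable c ∧ ∀ᵐ q ∂ν, ∀ᵐ t ∂(volume.restrict (Ioo 0 T)),
      w t q = c q + ∫ s in Ioo 0 t, g s q := by
  obtain ⟨η₀, hη₀, hη₀1⟩ := exists_isTestOn_integral_eq_one hT
  set H : ℝ → X → ℂ := fun t q => ∫ s in Ioo 0 t, g s q with hH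
  have hHs : IntegrableOnStrips T ν H := hg.primitive hgm
  have hHm : Measurable fun p : ℝ × X => H p.1 p.2 := measurable_primitive (ν := ν) hgm
  set K : ℝ → X → ℂ := fun t q => w t q - H t q with hK
  have hKs : IntegrableOnStrips T ν K := fun B hB hB' => (hw B hB hB').sub (hHs B hB hB')
  have hKm : Measurable fun p : ℝ × X => K p.1 p.2 := hwm.sub hHm
  have hmul : ∀ {ζ : ℝ → ℝ} {f : ℝ → ℂ}, IsTestOn T ζ → IntegrableOn f (Ioo 0 T) →
      IntegrableOn (fun t => (ζ t : ℂ) * f t) (Ioo 0 T) := by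
    intro ζ f hζ hf
    obtain ⟨C, hC⟩ := hζ.exists_bound
    exact hf.bdd_mul (c := C) (Complex.continuous_ofReal.comp hζ.contDiff.continuous).aestronglyMeasurable
      (Eventually.of_forall fun t => by simpa using hC t)
  have hK0 : ∀ η, IsTestOn T η → ∀ᵐ q ∂ν, ∫ t in Ioo 0 T, ((deriv η t : ℝ) : ℂ) * K t q = 0 := by
    intro η hη
    filter_upwards [h η hη, hw.ae_integrable, hg.ae_integrable, hHs.ae_integrable]
      with q hq hwq hgq hHq
    have h1 := integral_deriv_mul_primitive hη hgq
    rw [integral_add (hmul hη.deriv hwq) (hmul hη hgq)] at hq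
    simp_rw [hK, mul_sub]
    rw [integral_sub (hmul hη.deriv hwq) (hmul hη.deriv hHq), h1, sub_neg_eq_add, hq]
  set c : X → ℂ := fun q => ∫ t in Ioo 0 T, (η₀ t : ℂ) * K t q with hc
  have hη₀m : Measurable fun p : ℝ × X => (η₀ p.1 : ℂ) := Complex.measurable_ofReal.comp
    (hη₀.contDiff.continuous.measurable.comp measurable_fst)
  have hcm : Measurable c :=
    (StronglyMeasurable.integral_prod_left' (f := fun p : ℝ × X => (η₀ p.1 : ℂ) * K p.1 p.2)
      (hη₀m.mul hKm).stronglyMeasurable).measurable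
  have htest : ∀ ζ, IsTestOn T ζ →
      ∀ᵐ q ∂ν, ∫ t in Ioo 0 T, (ζ t : ℂ) * (K t q - c q) = 0 := by
    intro ζ hζ
    set Z := ∫ t in Ioo 0 T, ζ t with hZ
    have hζi : ∀ {ζ}, IsTestOn T ζ → IntegrableOn ζ (Ioo 0 T) := fun hζ =>
      (hζ.contDiff.continuous.integrable_of_hasCompactSupport hζ.hasCompactSupport).integrableOn
    obtain ⟨η, hη, hηd⟩ := (hζ.sub_const_mul hη₀ Z).exists_primitive hT (by
      rw [integral_sub (hζi hζ) ((hζi hη₀).const_mul _), integral_const_mul, hη₀1]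
      simp [hZ])
    filter_upwards [hK0 η hη, hKs.ae_integrable] with q hq hKq
    rw [hηd] at hq
    have e1 : ∀ t, ((ζ t - Z * η₀ t : ℝ) : ℂ) * K t q
        = (ζ t : ℂ) * K t q - Z * ((η₀ t : ℂ) * K t q) := fun t => by push_cast; ring
    simp_rw [e1] at hq
    rw [integral_sub (hmul hζ hKq) ((hmul hη₀ hKq).const_mul _), integral_const_mul] at hq
    simp_rw [mul_sub]
    have hζc : IntegrableOn (fun t => (ζ t : ℂ) * c q) (Ioo 0 T) := (hζi hζ).ofReal.mul_const _
    rw [integral_sub (hmul hζ hKq) hζc, integral_mul_const,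
      integral_complex_ofReal]
    exact hq
  refine ⟨c, hcm, ?_⟩
  refine ae_of_forall_measure_lt_top_ae_restrict _ fun B hB hB' => ?_
  have hci : Integrable c (ν.restrict B) := by
    obtain ⟨C, hC⟩ := hη₀.exists_bound
    have : Integrable (fun p : ℝ × X => (η₀ p.1 : ℂ) * K p.1 p.2)
        ((volume.restrict (Ioo 0 T)).prod (ν.restrict B)) :=
      (hKs B hB hB').bdd_mul (c := C) hη₀m.aestronglyMeasurable
        (Eventually.of_forall fun p => by simpa using hC p.1)
    exact this.integral_prod_right
  have hz := ae_eq_zero_of_forall_isTestOn (F := fun p : ℝ × X => K p.1 p.2 - c p.2)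
    ((hKs B hB hB').sub (hci.comp_snd _)) htest
  have hz' := Measure.ae_ae_of_ae_prod hz
  rw [Measure.ae_ae_comm (p := fun t q => K t q - c q = (0 : ℝ × X → ℂ) (t, q))
    (measurableSet_eq_fun (hKm.sub (hcm.comp measurable_snd)) measurable_const)] at hz'
  filter_upwards [hz'] with q hq
  filter_upwards [hq] with t ht
  have : w t q - H t q - c q = 0 := ht
  linear_combination this

end Parametric

section Weighted

theorem lintegral_ofReal_rpow {a b r : ℝ} (ha : 0 ≤ a) (hab : a ≤ b) (hr : -1 < r) :
    ∫⁻ t in Ioo a b, ENNReal.ofReal (t ^ r)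
      = ENNReal.ofReal ((b ^ (r + 1) - a ^ (r + 1)) / (r + 1)) := by
  rw [← integral_rpow (Or.inl hr), intervalIntegral.integral_of_le hab,
    integral_Ioc_eq_integral_Ioo, ofReal_integral_eq_lintegral_ofReal]
  · have := (intervalIntegral.intervalIntegrable_rpow' (a := a) (b := b) hr).1
    exact this.mono_set Ioo_subset_Ioc_self
  · exact (ae_restrict_iff' measurableSet_Ioo).2 (Eventually.of_forall fun t ht =>
      Real.rpow_nonneg (ha.trans ht.1.le) _)

theorem ofReal_mul_norm_sq {a : ℝ} (ha : 0 ≤ a) (z : ℂ) :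
    ENNReal.ofReal (a * ‖z‖ ^ 2) = ENNReal.ofReal a * ‖z‖ₑ ^ 2 := by
  rw [ENNReal.ofReal_mul ha, ENNReal.ofReal_pow (norm_nonneg _), ofReal_norm]

theorem sq_lintegral_enorm_le {f : ℝ → ℂ} (hf : Measurable f) (μ : ℝ) {S : Set ℝ}
    (hS : MeasurableSet S) (hS0 : S ⊆ Ioi 0) :
    (∫⁻ t in S, ‖f t‖ₑ) ^ 2 ≤ (∫⁻ t in S, ENNReal.ofReal (t ^ (2 * μ - 2)))
      * ∫⁻ t in S, ENNReal.ofReal (t ^ (2 - 2 * μ) * ‖f t‖ ^ 2) := by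
  have hrp : ∀ r : ℝ, Measurable fun t : ℝ => ENNReal.ofReal (t ^ r) := fun r =>
    (measurable_id.pow_const r).ennreal_ofReal
  have h := ENNReal.lintegral_mul_le_Lp_mul_Lq (volume.restrict S)
    (p := 2) (q := 2) Real.HolderConjugate.two_two
    (f := fun t => ENNReal.ofReal (t ^ (μ - 1)))
    (g := fun t => ENNReal.ofReal (t ^ (1 - μ)) * ‖f t‖ₑ)
    (hrp _).aemeasurable ((hrp _).mul hf.enorm).aemeasurable
  have e1 : ∫⁻ t in S, ‖f t‖ₑ = ∫⁻ t in S, ((fun t => ENNReal.ofReal (t ^ (μ - 1)))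
      * fun t => ENNReal.ofReal (t ^ (1 - μ)) * ‖f t‖ₑ) t := by
    refine setLIntegral_congr_fun hS fun t ht => ?_
    have ht : 0 < t := hS0 ht
    simp only [Pi.mul_apply]
    rw [← mul_assoc, ← ENNReal.ofReal_mul (Real.rpow_nonneg ht.le _), ← Real.rpow_add ht]
    simp
  have e2 : ∫⁻ t in S, ENNReal.ofReal (t ^ (2 * μ - 2))
      = ∫⁻ t in S, (ENNReal.ofReal (t ^ (μ - 1))) ^ (2 : ℝ) := by
    refine setLIntegral_congr_fun hS fun t ht => ?_
    have ht : 0 < t := hS0 ht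
    rw [ENNReal.rpow_two, ← ENNReal.ofReal_pow (Real.rpow_nonneg ht.le _), ← Real.rpow_mul_natCast ht.le]
    congr 2
    push_cast
    ring
  have e3 : ∫⁻ t in S, ENNReal.ofReal (t ^ (2 - 2 * μ) * ‖f t‖ ^ 2)
      = ∫⁻ t in S, (ENNReal.ofReal (t ^ (1 - μ)) * ‖f t‖ₑ) ^ (2 : ℝ) := by
    refine setLIntegral_congr_fun hS fun t ht => ?_
    have ht : 0 < t := hS0 ht
    rw [ofReal_mul_norm_sq (Real.rpow_nonneg ht.le _), ENNReal.rpow_two, mul_pow,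
      ← ENNReal.ofReal_pow (Real.rpow_nonneg ht.le _), ← Real.rpow_mul_natCast ht.le]
    congr 3
    push_cast
    ring
  rw [← e1, ← e2, ← e3] at h
  refine (pow_le_pow_left' h 2).trans_eq ?_
  rw [mul_pow, ← ENNReal.rpow_two, ← ENNReal.rpow_two, ← ENNReal.rpow_mul, ← ENNReal.rpow_mul]
  norm_num

theorem enorm_add_sq_le (a b : ℂ) : ‖a + b‖ₑ ^ 2 ≤ 2 * ‖a‖ₑ ^ 2 + 2 * ‖b‖ₑ ^ 2 := by
  have h : ‖a + b‖ ^ 2 ≤ 2 * ‖a‖ ^ 2 + 2 * ‖b‖ ^ 2 := by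
    have h1 := pow_le_pow_left₀ (norm_nonneg _) (norm_add_le a b) 2
    nlinarith [sq_nonneg (‖a‖ - ‖b‖)]
  have := ENNReal.ofReal_le_ofReal h
  rw [ENNReal.ofReal_add (by positivity) (by positivity), ENNReal.ofReal_mul (by norm_num),
    ENNReal.ofReal_mul (by norm_num), ENNReal.ofReal_pow (norm_nonneg _),
    ENNReal.ofReal_pow (norm_nonneg _), ENNReal.ofReal_pow (norm_nonneg _)] at this
  simpa [ofReal_norm] using this

variable {X : Type*} [MeasurableSpace X] {ν : Measure X} {T μ : ℝ}

/-- Squared norm of `L²_μ((0,T))` of a slice. -/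
def sliceEnergy (T μ : ℝ) (w : ℝ → X → ℂ) (q : X) : ℝ≥0∞ :=
  ∫⁻ t in Ioo 0 T, ENNReal.ofReal (t ^ (2 - 2 * μ) * ‖w t q‖ ^ 2)

theorem measurable_weight {w : ℝ → X → ℂ} (hw : Measurable fun p : ℝ × X => w p.1 p.2) :
    Measurable fun p : ℝ × X => ENNReal.ofReal (p.1 ^ (2 - 2 * μ) * ‖w p.1 p.2‖ ^ 2) :=
  ((measurable_fst.pow_const _).mul (hw.norm.pow_const 2)).ennreal_ofReal

theorem measurable_sliceEnergy {w : ℝ → X → ℂ} (hw : Measurable fun p : ℝ × X => w p.1 p.2) :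
    Measurable (sliceEnergy T μ w) :=
  (measurable_weight hw).lintegral_prod_left

theorem lintegral_sliceEnergy [SFinite ν] {w : ℝ → X → ℂ}
    (hw : Measurable fun p : ℝ × X => w p.1 p.2) :
    ∫⁻ q, sliceEnergy T μ w q ∂ν
      = ∫⁻ t in Ioo 0 T, ∫⁻ q, ENNReal.ofReal (t ^ (2 - 2 * μ) * ‖w t q‖ ^ 2) ∂ν :=
  (lintegral_lintegral_swap (measurable_weight hw).aemeasurable).symm

theorem integrableOnStrips_of_energy [SFinite ν] (hT : 0 < T) (hμ : 1 / 2 < μ) {w : ℝ → X → ℂ}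
    (hw : Measurable fun p : ℝ × X => w p.1 p.2) (hfin : ∫⁻ q, sliceEnergy T μ w q ∂ν < ⊤) :
    IntegrableOnStrips T ν w := by
  intro B hB hB'
  refine ⟨hw.aestronglyMeasurable, ?_⟩
  rw [HasFiniteIntegral, lintegral_prod_symm _ hw.enorm.aemeasurable]
  set M := ∫⁻ t in Ioo 0 T, ENNReal.ofReal (t ^ (2 * μ - 2)) with hM
  have hMtop : M < ⊤ := by
    rw [hM, lintegral_ofReal_rpow le_rfl hT.le (by linarith)]
    exact ENNReal.ofReal_lt_top
  have hle : ∀ q, ∫⁻ t in Ioo 0 T, ‖w t q‖ₑ ≤ 1 + M * sliceEnergy T μ w q := by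
    intro q
    refine le_trans ?_ (add_le_add_right (sq_lintegral_enorm_le
      (hw.comp (measurable_id.prodMk measurable_const)) μ measurableSet_Ioo fun t ht => ht.1) 1)
    set x := ∫⁻ t in Ioo 0 T, ‖w t q‖ₑ
    rcases le_total x 1 with h | h
    · exact h.trans le_self_add
    · exact (le_self_pow₀ h two_ne_zero).trans le_add_self
  refine (lintegral_mono hle).trans_lt ?_
  rw [lintegral_add_left measurable_const, lintegral_const_mul _ (measurable_sliceEnergy hw)]
  simp only [lintegral_const, one_mul, Measure.restrict_apply_univ]
  exact ENNReal.add_lt_top.2 ⟨hB', ENNReal.mul_lt_top hMtop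
    ((setLIntegral_le_lintegral _ _).trans_lt hfin)⟩

theorem enorm_primitive_sub_sq_le (hμ : 1 / 2 < μ) {g : ℝ → ℂ} (hgm : Measurable g)
    (hg : IntegrableOn g (Ioo 0 T)) {s t : ℝ} (hs : 0 ≤ s) (hst : s ≤ t) (ht : t ≤ T) :
    ‖(∫ r in Ioo 0 t, g r) - ∫ r in Ioo 0 s, g r‖ₑ ^ 2
      ≤ ENNReal.ofReal ((t ^ (2 * μ - 1) - s ^ (2 * μ - 1)) / (2 * μ - 1))
        * ∫⁻ r in Ioo 0 T, ENNReal.ofReal (r ^ (2 - 2 * μ) * ‖g r‖ ^ 2) := by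
  have hgi : ∀ a b, 0 ≤ a → a ≤ b → b ≤ T → IntervalIntegrable g volume a b := fun a b ha hab hb => by
    rw [intervalIntegrable_iff_integrableOn_Ioo_of_le hab]
    exact hg.mono_set (Ioo_subset_Ioo ha hb)
  have h0 : ∀ a b : ℝ, a ≤ b → ∫ r in Ioo a b, g r = ∫ r in a..b, g r := fun a b hab => by
    rw [intervalIntegral.integral_of_le hab, integral_Ioc_eq_integral_Ioo]
  have e : (∫ r in Ioo 0 t, g r) - ∫ r in Ioo 0 s, g r = ∫ r in Ioo s t, g r := by
    rw [h0 _ _ (hs.trans hst), h0 _ _ hs, h0 _ _ hst]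
    exact intervalIntegral.integral_interval_sub_left (hgi 0 t le_rfl (hs.trans hst) ht)
      (hgi 0 s le_rfl hs (hst.trans ht))
  rw [e]
  refine (pow_le_pow_left' (enorm_integral_le_lintegral_enorm _) 2).trans ?_
  refine (sq_lintegral_enorm_le hgm μ measurableSet_Ioo fun r hr => hs.trans_lt hr.1).trans ?_
  rw [lintegral_ofReal_rpow hs hst (by linarith)]
  have : 2 * μ - 2 + 1 = 2 * μ - 1 := by ring
  rw [this]
  gcongr

theorem lintegral_enorm_primitive_sub_sq_le [SigmaFinite ν] (hμ : 1 / 2 < μ)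
    {g : ℝ → X → ℂ} (hgm : Measurable fun p : ℝ × X => g p.1 p.2) (hg : IntegrableOnStrips T ν g)
    (c : X → ℂ) {s t : ℝ} (hs : s ∈ Icc 0 T) (ht : t ∈ Icc 0 T) :
    ∫⁻ q, ‖(c q + ∫ r in Ioo 0 t, g r q) - (c q + ∫ r in Ioo 0 s, g r q)‖ₑ ^ 2 ∂ν
      ≤ ENNReal.ofReal (|t ^ (2 * μ - 1) - s ^ (2 * μ - 1)| / (2 * μ - 1))
        * ∫⁻ q, sliceEnergy T μ g q ∂ν := by
  rw [← lintegral_const_mul _ (measurable_sliceEnergy hgm)]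
  refine lintegral_mono_ae ?_
  filter_upwards [hg.ae_integrable] with q hq
  have hm : Measurable fun t => g t q := hgm.comp (measurable_id.prodMk measurable_const)
  have h0 : 0 < 2 * μ - 1 := by linarith
  rw [add_sub_add_left_eq_sub]
  rcases le_total s t with h | h
  · rw [abs_of_nonneg (sub_nonneg.2 (Real.rpow_le_rpow hs.1 h h0.le))]
    exact enorm_primitive_sub_sq_le hμ hm hq hs.1 h ht.2
  · rw [abs_sub_comm, abs_of_nonneg (sub_nonneg.2 (Real.rpow_le_rpow ht.1 h h0.le)), enorm_sub_rev]
    exact enorm_primitive_sub_sq_le hμ hm hq ht.1 h hs.2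

/-- The constant in the trace estimate. -/
def traceConst (T μ : ℝ) : ℝ :=
  2 * (3 - 2 * μ) / T ^ (3 - 2 * μ) + 2 * T ^ (2 * μ - 1) / (2 * μ - 1)

theorem traceConst_pos (hT : 0 < T) (hμ : 1 / 2 < μ) (hμ1 : μ ≤ 1) : 0 < traceConst T μ := by
  have h1 : 0 < 3 - 2 * μ := by linarith
  have h2 : 0 < 2 * μ - 1 := by linarith
  unfold traceConst
  positivity

theorem lintegral_enorm_sq_le [SigmaFinite ν] (hT : 0 < T) (hμ : 1 / 2 < μ) (hμ1 : μ ≤ 1)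
    {w g : ℝ → X → ℂ} (hwm : Measurable fun p : ℝ × X => w p.1 p.2)
    (hgm : Measurable fun p : ℝ × X => g p.1 p.2) (hg : IntegrableOnStrips T ν g)
    {c : X → ℂ} (hc : ∀ᵐ q ∂ν, ∀ᵐ t ∂(volume.restrict (Ioo 0 T)),
      w t q = c q + ∫ s in Ioo 0 t, g s q) {t : ℝ} (ht : t ∈ Icc 0 T) :
    ∫⁻ q, ‖c q + ∫ r in Ioo 0 t, g r q‖ₑ ^ 2 ∂ν
      ≤ ENNReal.ofReal (traceConst T μ)
        * (∫⁻ q, sliceEnergy T μ w q ∂ν + ∫⁻ q, sliceEnergy T μ g q ∂ν) := by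
  have h1 : 0 < 3 - 2 * μ := by linarith
  have h2 : 0 < 2 * μ - 1 := by linarith
  have hTp : 0 < T ^ (3 - 2 * μ) := Real.rpow_pos_of_pos hT _
  have hTp' : 0 < T ^ (2 * μ - 1) := Real.rpow_pos_of_pos hT _
  have hsum : Measurable fun q => sliceEnergy T μ w q + sliceEnergy T μ g q :=
    (measurable_sliceEnergy hwm).add (measurable_sliceEnergy hgm)
  rw [← lintegral_add_left (measurable_sliceEnergy hwm), ← lintegral_const_mul _ hsum]
  refine lintegral_mono_ae ?_
  filter_upwards [hg.ae_integrable, hc] with q hq hcq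
  have hm : Measurable fun t => g t q := hgm.comp (measurable_id.prodMk measurable_const)
  have hwq : Measurable fun t => w t q := hwm.comp (measurable_id.prodMk measurable_const)
  set z := c q + ∫ r in Ioo 0 t, g r q with hz
  set M := T ^ (2 * μ - 1) / (2 * μ - 1) with hM
  set N := T ^ (3 - 2 * μ) / (3 - 2 * μ) with hN
  have hNpos : 0 < N := by positivity
  have hpt : ∀ᵐ s ∂(volume.restrict (Ioo 0 T)),
      ‖z‖ₑ ^ 2 ≤ 2 * ‖w s q‖ₑ ^ 2 + 2 * (ENNReal.ofReal M * sliceEnergy T μ g q) := by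
    filter_upwards [hcq, ae_restrict_mem measurableSet_Ioo] with s hs hsI
    have e : z = w s q + ((∫ r in Ioo 0 t, g r q) - ∫ r in Ioo 0 s, g r q) := by
      rw [hs, hz]; ring
    rw [e]
    refine (enorm_add_sq_le _ _).trans ?_
    gcongr
    have key : ∀ a b : ℝ, 0 ≤ a → a ≤ b → b ≤ T →
        ‖(∫ r in Ioo 0 b, g r q) - ∫ r in Ioo 0 a, g r q‖ₑ ^ 2
          ≤ ENNReal.ofReal M * sliceEnergy T μ g q := fun a b ha hab hb => by
      refine (enorm_primitive_sub_sq_le hμ hm hq ha hab hb).trans ?_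
      unfold sliceEnergy
      gcongr
      have := Real.rpow_nonneg ha (2 * μ - 1)
      have := Real.rpow_le_rpow (ha.trans hab) hb h2.le
      rw [hM]
      gcongr
      linarith
    rcases le_total s t with h | h
    · exact key s t hsI.1.le h ht.2
    · rw [enorm_sub_rev]
      exact key t s ht.1 h hsI.2.le
  have hrp : Measurable fun t : ℝ => ENNReal.ofReal (t ^ (2 - 2 * μ)) :=
    (measurable_id.pow_const _).ennreal_ofReal
  have hNint : ∫⁻ s in Ioo 0 T, ENNReal.ofReal (s ^ (2 - 2 * μ)) = ENNReal.ofReal N := by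
    rw [lintegral_ofReal_rpow le_rfl hT.le (by linarith)]
    have : 2 - 2 * μ + 1 = 3 - 2 * μ := by ring
    rw [this, Real.zero_rpow h1.ne', sub_zero]
  have hwt : Measurable fun t => ENNReal.ofReal (t ^ (2 - 2 * μ) * ‖w t q‖ ^ 2) :=
    (measurable_weight hwm).comp (measurable_id.prodMk (measurable_const (a := q)))
  have hInt : ENNReal.ofReal N * ‖z‖ₑ ^ 2 ≤ 2 * sliceEnergy T μ w q
      + ENNReal.ofReal N * (2 * (ENNReal.ofReal M * sliceEnergy T μ g q)) := by
    rw [← hNint, ← lintegral_mul_const _ hrp, ← lintegral_mul_const _ hrp, sliceEnergy,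
      ← lintegral_const_mul _ hwt, ← lintegral_add_right _ (hrp.mul_const _)]
    refine lintegral_mono_ae ?_
    filter_upwards [hpt, ae_restrict_mem measurableSet_Ioo] with s hs hsI
    refine (mul_le_mul_right hs _).trans_eq ?_
    rw [ofReal_mul_norm_sq (Real.rpow_nonneg hsI.1.le _)]
    ring
  have hN0 : ENNReal.ofReal N ≠ 0 := by simpa using hNpos
  have hz2 : ‖z‖ₑ ^ 2 ≤ ENNReal.ofReal (2 / N) * sliceEnergy T μ w q
      + ENNReal.ofReal (2 * M) * sliceEnergy T μ g q := by
    rw [← ENNReal.mul_le_mul_iff_right hN0 ENNReal.ofReal_ne_top]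
    refine hInt.trans_eq ?_
    rw [mul_add, ← mul_assoc _ (ENNReal.ofReal (2 / N)), ← ENNReal.ofReal_mul hNpos.le, mul_div_cancel₀ _ hNpos.ne',
      ENNReal.ofReal_mul zero_le_two]
    simp only [ENNReal.ofReal_ofNat]
    ring
  refine hz2.trans ?_
  have hMpos : 0 < M := by positivity
  have htc : traceConst T μ = 2 / N + 2 * M := by
    rw [traceConst, hN, hM]; field_simp
  rw [mul_add, htc]
  gcongr
  · have : 0 ≤ 2 * M := by positivity
    linarith
  · have : 0 ≤ 2 / N := by positivity
    linarith

end Weighted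

section Flow

variable {n : ℕ}

/-- The free transport flow `(x, v) ↦ (x + s v, v)`. -/
def transportFlow (n : ℕ) (s : ℝ) : (En n × En n) ≃ₜ (En n × En n) where
  toFun q := (q.1 + s • q.2, q.2)
  invFun q := (q.1 - s • q.2, q.2)
  left_inv q := by simp
  right_inv q := by simp
  continuous_toFun := by fun_prop
  continuous_invFun := by fun_prop

theorem transportFlow_apply (s : ℝ) (q : En n × En n) :
    transportFlow n s q = (q.1 + s • q.2, q.2) := rfl

theorem transportFlow_symm_apply (s : ℝ) (q : En n × En n) :
    (transportFlow n s).symm q = (q.1 - s • q.2, q.2) := rfl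

theorem measurePreserving_transportFlow (s : ℝ) :
    MeasurePreserving (transportFlow n s) (volume : Measure (En n × En n)) volume := by
  have h : MeasurePreserving (fun p : En n × En n => (p.1, p.2 + s • p.1))
      (volume.prod volume) (volume.prod volume) :=
    (MeasurePreserving.id volume).skew_product (g := fun v x => x + s • v)
      (by fun_prop) (Eventually.of_forall fun v => map_add_right_eq_self volume (s • v))
  have hs := Measure.measurePreserving_swap (μ := (volume : Measure (En n)))
    (ν := (volume : Measure (En n)))
  exact (hs.comp h).comp hs

theorem measurePreserving_transportFlow_symm (s : ℝ) :
    MeasurePreserving (transportFlow n s).symm (volume : Measure (En n × En n)) volume :=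
  MeasurePreserving.symm (transportFlow n s).toMeasurableEquiv (measurePreserving_transportFlow s)

theorem continuous_transportFlow_symm_uncurry :
    Continuous fun p : ℝ × (En n × En n) => (transportFlow n p.1).symm p.2 := by
  simp only [transportFlow_symm_apply]
  fun_prop

/-- The straightening `(t, q) ↦ (t, Φ_{-t} q)` of the transport flow `Φ`. -/
def straighten (n : ℕ) : (ℝ × (En n × En n)) ≃ₜ (ℝ × (En n × En n)) where
  toFun p := (p.1, (transportFlow n p.1).symm p.2)
  invFun p := (p.1, transportFlow n p.1 p.2)
  left_inv p := by simp
  right_inv p := by simp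
  continuous_toFun := continuous_fst.prodMk continuous_transportFlow_symm_uncurry
  continuous_invFun := by
    simp only [transportFlow_apply]
    fun_prop

theorem measurable_comp_flow {w : ℝ → En n × En n → ℂ}
    (hw : Measurable fun q : ℝ × (En n × En n) => w q.1 q.2) :
    Measurable fun p : ℝ × (En n × En n) => w p.1 (transportFlow n p.1 p.2) :=
  hw.comp (straighten n).symm.continuous.measurable

/-- Test function transported along the flow. -/
def flowTest (n : ℕ) (η : ℝ → ℝ) (ψ : En n × En n → ℝ) (p : ℝ × (En n × En n)) : ℝ :=
  η p.1 * ψ ((transportFlow n p.1).symm p.2)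

theorem contDiff_flowTest {η : ℝ → ℝ} {ψ : En n × En n → ℝ}
    (hη : ContDiff ℝ ((⊤ : ℕ∞) : WithTop ℕ∞) η) (hψ : ContDiff ℝ ((⊤ : ℕ∞) : WithTop ℕ∞) ψ) :
    ContDiff ℝ ((⊤ : ℕ∞) : WithTop ℕ∞) (flowTest n η ψ) := by
  unfold flowTest
  simp only [transportFlow_symm_apply]
  fun_prop

theorem hasCompactSupport_flowTest {η : ℝ → ℝ} {ψ : En n × En n → ℝ}
    (hη : HasCompactSupport η) (hψ : HasCompactSupport ψ) :
    HasCompactSupport (flowTest n η ψ) := by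
  have h : HasCompactSupport fun p : ℝ × (En n × En n) => η p.1 * ψ p.2 := by
    refine HasCompactSupport.of_support_subset_isCompact
      (hη.isCompact.prod hψ.isCompact) fun p hp => ?_
    exact ⟨subset_tsupport _ (left_ne_zero_of_mul hp), subset_tsupport _ (right_ne_zero_of_mul hp)⟩
  exact h.comp_homeomorph (straighten n)

theorem fderiv_flowTest {η : ℝ → ℝ} {ψ : En n × En n → ℝ}
    (hη : ContDiff ℝ ((⊤ : ℕ∞) : WithTop ℕ∞) η) (hψ : ContDiff ℝ ((⊤ : ℕ∞) : WithTop ℕ∞) ψ)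
    (t : ℝ) (q : En n × En n) :
    fderiv ℝ (flowTest n η ψ) (t, q) ((1 : ℝ), (q.2, (0 : En n)))
      = deriv η t * ψ ((transportFlow n t).symm q) := by
  have hd : HasFDerivAt (flowTest n η ψ) (fderiv ℝ (flowTest n η ψ) (t, q)) (t, q) :=
    ((contDiff_flowTest hη hψ).differentiable (by simp) _).hasFDerivAt
  have hline : HasDerivAt (fun s : ℝ => (s, (q.1 + (s - t) • q.2, q.2)))
      ((1 : ℝ), (q.2, (0 : En n))) t := by
    refine (hasDerivAt_id t).prodMk (HasDerivAt.prodMk ?_ (hasDerivAt_const t q.2))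
    have := (((hasDerivAt_id t).sub_const t).smul_const q.2).const_add q.1
    simpa using this
  have hd' : HasFDerivAt (flowTest n η ψ) (fderiv ℝ (flowTest n η ψ) (t, q))
      ((fun s : ℝ => (s, (q.1 + (s - t) • q.2, q.2))) t) := by simpa using hd
  have h1 := hd'.comp_hasDerivAt t hline
  have h2 : HasDerivAt (flowTest n η ψ ∘ fun s : ℝ => (s, (q.1 + (s - t) • q.2, q.2)))
      (deriv η t * ψ ((transportFlow n t).symm q)) t := by
    have e : (flowTest n η ψ ∘ fun s : ℝ => (s, (q.1 + (s - t) • q.2, q.2)))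
        = fun s => η s * ψ ((transportFlow n t).symm q) := by
      funext s
      simp only [flowTest, Function.comp_apply, transportFlow_symm_apply]
      congr 3
      module
    rw [e]
    exact (((hη.differentiable (by simp)) t).hasDerivAt).mul_const _
  exact h1.unique h2

theorem integrable_mul_mul_of_strips {X : Type*} [MeasurableSpace X] {ν : Measure X} [SFinite ν]
    {T : ℝ} {w : ℝ → X → ℂ} (hw : IntegrableOnStrips T ν w) {η : ℝ → ℝ} (hη : IsTestOn T η)
    {ψ : X → ℝ} (hψ : Measurable ψ) {C : ℝ} (hC : ∀ q, ‖ψ q‖ ≤ C) {B : Set X}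
    (hB : MeasurableSet B) (hB' : ν B < ⊤) (hψB : ∀ q, q ∉ B → ψ q = 0) :
    Integrable (fun p : ℝ × X => (ψ p.2 : ℂ) * ((η p.1 : ℂ) * w p.1 p.2))
      ((volume.restrict (Ioo 0 T)).prod ν) := by
  obtain ⟨D, hD⟩ := hη.exists_bound
  have h1 : Integrable (fun p : ℝ × X => (ψ p.2 : ℂ) * ((η p.1 : ℂ) * w p.1 p.2))
      ((volume.restrict (Ioo 0 T)).prod (ν.restrict B)) := by
    refine ((hw B hB hB').bdd_mul (c := D) ?_
      (Eventually.of_forall fun p => by simpa using hD p.1)).bdd_mul (c := C) ?_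
      (Eventually.of_forall fun p => by simpa using hC p.2)
    · exact (Complex.measurable_ofReal.comp
        (hη.contDiff.continuous.measurable.comp measurable_fst)).aestronglyMeasurable
    · exact (Complex.measurable_ofReal.comp (hψ.comp measurable_snd)).aestronglyMeasurable
  have h2 : IntegrableOn (fun p : ℝ × X => (ψ p.2 : ℂ) * ((η p.1 : ℂ) * w p.1 p.2))
      (univ ×ˢ B) ((volume.restrict (Ioo 0 T)).prod ν) := by
    rwa [IntegrableOn, ← Measure.prod_restrict, Measure.restrict_univ]
  refine (integrableOn_iff_integrable_of_support_subset fun p hp => ?_).1 h2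
  refine ⟨mem_univ _, by_contra fun h => hp ?_⟩
  simp [hψB _ h]

/-- Along the transport flow, the transport derivative becomes the weak time derivative of almost
every slice. -/
theorem IsTransportDeriv.ae_slice {T : ℝ} {u h : ℝ → En n × En n → ℂ}
    (huh : IsTransportDeriv n T u h)
    (hw : IntegrableOnStrips T volume fun t q => u t (transportFlow n t q))
    (hg : IntegrableOnStrips T volume fun t q => h t (transportFlow n t q))
    {η : ℝ → ℝ} (hη : IsTestOn T η) :
    ∀ᵐ q, ∫ t in Ioo 0 T, (((deriv η t : ℝ) : ℂ) * u t (transportFlow n t q)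
      + (η t : ℂ) * h t (transportFlow n t q)) = 0 := by
  set w : ℝ → En n × En n → ℂ := fun t q => u t (transportFlow n t q) with hwdef
  set g : ℝ → En n × En n → ℂ := fun t q => h t (transportFlow n t q) with hgdef
  refine ae_eq_zero_of_integral_contDiff_smul_eq_zero ?_ fun ψ hψ hψc => ?_
  · rw [MeasureTheory.locallyIntegrable_iff]
    intro K hK
    have hone : ∀ {f : ℝ → En n × En n → ℂ} {ζ : ℝ → ℝ}, IntegrableOnStrips T volume f →
        IsTestOn T ζ → Integrable (fun p : ℝ × (En n × En n) => (ζ p.1 : ℂ) * f p.1 p.2)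
          ((volume.restrict (Ioo 0 T)).prod (volume.restrict K)) := by
      intro f ζ hf hζ
      obtain ⟨D, hD⟩ := hζ.exists_bound
      exact (hf K hK.measurableSet hK.measure_lt_top).bdd_mul (c := D) (Complex.measurable_ofReal.comp
        (hζ.contDiff.continuous.measurable.comp measurable_fst)).aestronglyMeasurable
        (Eventually.of_forall fun p => by simpa using hD p.1)
    exact ((hone hw hη.deriv).add (hone hg hη)).integral_prod_right
  · obtain ⟨C, hC⟩ := hψc.exists_bound_of_continuous hψ.continuous
    have hInt : ∀ {f : ℝ → En n × En n → ℂ} {ζ : ℝ → ℝ}, IntegrableOnStrips T volume f →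
        IsTestOn T ζ → Integrable (fun p : ℝ × (En n × En n) => (ψ p.2 : ℂ) * ((ζ p.1 : ℂ) * f p.1 p.2))
          ((volume.restrict (Ioo 0 T)).prod volume) := fun hf hζ =>
      integrable_mul_mul_of_strips hf hζ hψ.continuous.measurable hC hψc.isCompact.measurableSet
        hψc.isCompact.measure_lt_top fun q hq => image_eq_zero_of_notMem_tsupport hq
    have hcv : ∀ (f : ℝ → En n × En n → ℂ) (ζ : ℝ → ℝ) (t : ℝ),
        ∫ q, f t q * ((ζ t * ψ ((transportFlow n t).symm q) : ℝ) : ℂ)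
          = ∫ q, (ψ q : ℂ) * ((ζ t : ℂ) * f t (transportFlow n t q)) := by
      intro f ζ t
      rw [← MeasurePreserving.integral_comp' (f := (transportFlow n t).toMeasurableEquiv)
        (measurePreserving_transportFlow t)]
      refine integral_congr_ae (Eventually.of_forall fun q => ?_)
      simp only [Homeomorph.toMeasurableEquiv_coe, Homeomorph.symm_apply_apply]
      push_cast
      ring
    have hmain := huh (flowTest n η ψ) (contDiff_flowTest hη.contDiff hψ)
      (hasCompactSupport_flowTest hη.hasCompactSupport hψc)
      (fun p hp => by simp [flowTest, hη.eq_zero hp])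
    simp_rw [fderiv_flowTest hη.contDiff hψ] at hmain
    simp only [flowTest] at hmain
    simp_rw [hcv u (deriv η), hcv h η] at hmain
    have hadd : Integrable (fun p : ℝ × (En n × En n) =>
        (ψ p.2 : ℂ) * (((deriv η p.1 : ℝ) : ℂ) * w p.1 p.2) + (ψ p.2 : ℂ) * ((η p.1 : ℂ) * g p.1 p.2))
        ((volume.restrict (Ioo 0 T)).prod volume) := (hInt hw hη.deriv).add (hInt hg hη)
    have hswap := integral_integral_swap
      (f := fun t q => (ψ q : ℂ) * (((deriv η t : ℝ) : ℂ) * w t q) + (ψ q : ℂ) * ((η t : ℂ) * g t q)) hadd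
    have hsplit := integral_add (hInt hw hη.deriv) (hInt hg hη)
    rw [integral_prod _ (hInt hw hη.deriv), integral_prod _ (hInt hg hη),
      integral_prod _ hadd] at hsplit
    have e : ∀ q, ψ q • (∫ t in Ioo 0 T, (((deriv η t : ℝ) : ℂ) * w t q + (η t : ℂ) * g t q))
        = ∫ t in Ioo 0 T, ((ψ q : ℂ) * (((deriv η t : ℝ) : ℂ) * w t q)
          + (ψ q : ℂ) * ((η t : ℂ) * g t q)) := by
      intro q
      rw [Complex.real_smul, ← integral_const_mul]
      simp_rw [mul_add]
    refine (integral_congr_ae (Eventually.of_forall e)).trans ?_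
    refine (hswap.symm.trans hsplit).trans ?_
    rw [← hmain]
    exact add_neg_cancel _

theorem tendsto_lintegral_comp_flow_sub {f : En n × En n → ℂ} (hf : MemLp f 2 volume) (t₀ : ℝ) :
    Tendsto (fun t => ∫⁻ q, ‖f ((transportFlow n t).symm q) - f ((transportFlow n t₀).symm q)‖ₑ ^ 2)
      (nhds t₀) (nhds 0) := by
  let Φ : C(ℝ, C(En n × En n, En n × En n)) :=
    ContinuousMap.curry ⟨_, continuous_transportFlow_symm_uncurry⟩
  have hΦ : ∀ t, MeasurePreserving (Φ t) (volume : Measure (En n × En n)) volume :=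
    measurePreserving_transportFlow_symm
  have hc : Continuous fun t => Lp.compMeasurePreserving (Φ t) (hΦ t) (hf.toLp f) :=
    continuous_const.compMeasurePreservingLp Φ.continuous hΦ (by simp)
  have h1 := (tendsto_iff_edist_tendsto_0.1 (hc.tendsto t₀))
  have h2 := (ENNReal.continuous_pow 2).tendsto 0 |>.comp h1
  simp only [ne_eq, OfNat.ofNat_ne_zero, not_false_eq_true, zero_pow] at h2
  refine h2.congr fun t => ?_
  have ht : ∀ t, Lp.compMeasurePreserving (Φ t) (hΦ t) (hf.toLp f)
      = (hf.comp_measurePreserving (hΦ t)).toLp (f ∘ Φ t) := fun t => rfl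
  rw [Function.comp_apply, ht, ht, Lp.edist_toLp_toLp,
    eLpNorm_eq_lintegral_rpow_enorm_toReal two_ne_zero (by simp), ← ENNReal.rpow_two,
    ← ENNReal.rpow_mul]
  simp only [ENNReal.toReal_ofNat, ENNReal.rpow_two]
  norm_num
  rfl

theorem lintegral_sliceEnergy_comp_flow {T μ : ℝ} {w : ℝ → En n × En n → ℂ}
    (hw : Measurable fun q : ℝ × (En n × En n) => w q.1 q.2) :
    ∫⁻ q, sliceEnergy T μ (fun t q => w t (transportFlow n t q)) q = L2mu n T μ w := by
  rw [lintegral_sliceEnergy (measurable_comp_flow hw), L2mu]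
  refine lintegral_congr fun t => ?_
  exact (measurePreserving_transportFlow t).lintegral_comp
    (f := fun q => ENNReal.ofReal (t ^ (2 - 2 * μ) * ‖w t q‖ ^ 2))
    ((measurable_weight hw).comp (measurable_const.prodMk measurable_id))

end Flow

section Trace

variable {n : ℕ} {T μ : ℝ}

/-- A solution along characteristics, transported back to the original variables. -/
def flowSolution (c : En n × En n → ℂ) (g : ℝ → En n × En n → ℂ) (t : ℝ) (q : En n × En n) : ℂ :=
  c ((transportFlow n t).symm q) + ∫ s in Ioo 0 t, g s ((transportFlow n t).symm q)

theorem measurable_add_primitive {c : En n × En n → ℂ} (hc : Measurable c)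
    {g : ℝ → En n × En n → ℂ} (hg : Measurable fun p : ℝ × (En n × En n) => g p.1 p.2) (t : ℝ) :
    Measurable fun q => c q + ∫ s in Ioo 0 t, g s q :=
  hc.add ((measurable_primitive (ν := volume) hg).comp (measurable_const.prodMk measurable_id))

theorem flowSolution_ae_eq {c : En n × En n → ℂ} (hc : Measurable c) {u g : ℝ → En n × En n → ℂ}
    (hu : Measurable fun p : ℝ × (En n × En n) => u p.1 p.2)
    (hg : Measurable fun p : ℝ × (En n × En n) => g p.1 p.2)
    (h : ∀ᵐ q, ∀ᵐ t ∂(volume.restrict (Ioo 0 T)),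
      u t (transportFlow n t q) = c q + ∫ s in Ioo 0 t, g s q) :
    ∀ᵐ t ∂(volume.restrict (Ioo 0 T)), ∀ᵐ q, flowSolution c g t q = u t q := by
  rw [← Measure.ae_ae_comm
    (p := fun t q => u t (transportFlow n t q) = c q + ∫ s in Ioo 0 t, g s q)
    (measurableSet_eq_fun (measurable_comp_flow hu)
      ((hc.comp measurable_snd).add (measurable_primitive (ν := volume) hg)))] at h
  filter_upwards [h] with t ht
  filter_upwards [(measurePreserving_transportFlow_symm t).quasiMeasurePreserving.ae ht] with q hq
  rw [Homeomorph.apply_symm_apply] at hq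
  exact hq.symm

theorem lintegral_enorm_sq_flowSolution {c : En n × En n → ℂ} (hc : Measurable c)
    {g : ℝ → En n × En n → ℂ} (hg : Measurable fun p : ℝ × (En n × En n) => g p.1 p.2) (t : ℝ) :
    ∫⁻ q, ‖flowSolution c g t q‖ₑ ^ 2 = ∫⁻ q, ‖c q + ∫ s in Ioo 0 t, g s q‖ₑ ^ 2 :=
  (measurePreserving_transportFlow_symm t).lintegral_comp
    ((measurable_add_primitive hc hg t).enorm.pow_const 2)

theorem tendsto_lintegral_flowSolution_sub (hμ : 1 / 2 < μ)
    {c : En n × En n → ℂ} (hc : Measurable c) {g : ℝ → En n × En n → ℂ}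
    (hgm : Measurable fun p : ℝ × (En n × En n) => g p.1 p.2)
    (hg : IntegrableOnStrips T volume g) (hfin : ∫⁻ q, sliceEnergy T μ g q < ⊤)
    {t₀ : ℝ} (ht₀ : t₀ ∈ Icc 0 T) (hL : ∫⁻ q, ‖c q + ∫ s in Ioo 0 t₀, g s q‖ₑ ^ 2 < ⊤) :
    Tendsto (fun t => ∫⁻ q, ‖flowSolution c g t q - flowSolution c g t₀ q‖ₑ ^ 2)
      (nhdsWithin t₀ (Icc 0 T)) (nhds 0) := by
  have h0 : 0 < 2 * μ - 1 := by linarith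
  have hWm := measurable_add_primitive hc hgm
  set W : ℝ → En n × En n → ℂ := fun t q => c q + ∫ s in Ioo 0 t, g s q with hW
  set E := ∫⁻ q, sliceEnergy T μ g q
  have hmem : MemLp (W t₀) 2 volume := by
    refine ⟨(hWm t₀).aestronglyMeasurable, ?_⟩
    rw [eLpNorm_lt_top_iff_lintegral_rpow_enorm_lt_top two_ne_zero (by simp)]
    simpa using hL
  have hA : Tendsto (fun t : ℝ => ENNReal.ofReal
      (|t ^ (2 * μ - 1) - t₀ ^ (2 * μ - 1)| / (2 * μ - 1)) * E)
      (nhdsWithin t₀ (Icc 0 T)) (nhds 0) := by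
    have h1 : Continuous fun t : ℝ => ENNReal.ofReal
        (|t ^ (2 * μ - 1) - t₀ ^ (2 * μ - 1)| / (2 * μ - 1)) :=
      ENNReal.continuous_ofReal.comp
        ((((Real.continuous_rpow_const h0.le).sub continuous_const).abs).div_const _)
    have h2 := ENNReal.Tendsto.mul_const (b := E) ((h1.tendsto t₀).mono_left
      (nhdsWithin_le_nhds (s := Icc 0 T))) (Or.inr hfin.ne)
    simpa using h2
  have hB := (tendsto_lintegral_comp_flow_sub hmem t₀).mono_left
    (nhdsWithin_le_nhds (s := Icc 0 T))
  have hAB : Tendsto (fun t : ℝ => 2 * (ENNReal.ofReal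
      (|t ^ (2 * μ - 1) - t₀ ^ (2 * μ - 1)| / (2 * μ - 1)) * E)
      + 2 * ∫⁻ q, ‖W t₀ ((transportFlow n t).symm q) - W t₀ ((transportFlow n t₀).symm q)‖ₑ ^ 2)
      (nhdsWithin t₀ (Icc 0 T)) (nhds 0) := by
    simpa using (ENNReal.Tendsto.const_mul hA (Or.inr ENNReal.ofNat_ne_top)).add
      (ENNReal.Tendsto.const_mul (a := 2) hB (Or.inr ENNReal.ofNat_ne_top))
  refine tendsto_of_tendsto_of_tendsto_of_le_of_le' tendsto_const_nhds hAB
    (Eventually.of_forall fun _ => zero_le) ?_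
  filter_upwards [self_mem_nhdsWithin] with t ht
  have hdm : Measurable fun q => ‖W t q - W t₀ q‖ₑ ^ 2 := ((hWm t).sub (hWm t₀)).enorm.pow_const 2
  have hΦ := measurePreserving_transportFlow_symm (n := n) t
  have hdm' : Measurable fun q =>
      ‖W t ((transportFlow n t).symm q) - W t₀ ((transportFlow n t).symm q)‖ₑ ^ 2 :=
    hdm.comp hΦ.measurable
  calc ∫⁻ q, ‖flowSolution c g t q - flowSolution c g t₀ q‖ₑ ^ 2
      ≤ ∫⁻ q, (2 * ‖W t ((transportFlow n t).symm q) - W t₀ ((transportFlow n t).symm q)‖ₑ ^ 2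
        + 2 * ‖W t₀ ((transportFlow n t).symm q) - W t₀ ((transportFlow n t₀).symm q)‖ₑ ^ 2) := by
        refine lintegral_mono fun q => ?_
        refine le_trans (le_of_eq ?_) (enorm_add_sq_le _ _)
        rw [sub_add_sub_cancel]
        rfl
    _ = 2 * (∫⁻ q, ‖W t q - W t₀ q‖ₑ ^ 2)
        + 2 * ∫⁻ q, ‖W t₀ ((transportFlow n t).symm q) - W t₀ ((transportFlow n t₀).symm q)‖ₑ ^ 2 := by
        rw [lintegral_add_left (hdm'.const_mul 2),
          lintegral_const_mul 2 hdm',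
          lintegral_const_mul' _ _ ENNReal.ofNat_ne_top, ← hΦ.lintegral_comp hdm]
    _ ≤ _ := by
        gcongr
        exact lintegral_enorm_primitive_sub_sq_le hμ hgm hg c ht₀ ht

end Trace

theorem stmt11 (n : ℕ) (hn : 1 ≤ n) (T μ : ℝ) (hT : 0 < T) (hμ : μ ∈ Ioc (1/2 : ℝ) 1) :
    ∃ C : ℝ, 0 < C ∧ ∀ u h : ℝ → En n × En n → ℂ,
      Measurable (fun q : ℝ × (En n × En n) => u q.1 q.2) →
      Measurable (fun q : ℝ × (En n × En n) => h q.1 q.2) →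
      L2mu n T μ u < ⊤ → L2mu n T μ h < ⊤ → IsTransportDeriv n T u h →
      ∃ v : ℝ → En n × En n → ℂ,
        -- `v` is a representative of `u`
        (∀ᵐ t ∂(volume.restrict (Ioo 0 T)),
          ∀ᵐ q ∂(volume : Measure (En n × En n)), v t q = u t q) ∧
        -- `v : [0,T] → L²(ℝ^{2n})` is continuous
        (∀ t₀ ∈ Icc (0:ℝ) T,
          Tendsto (fun t : ℝ => ∫⁻ q : En n × En n, ENNReal.ofReal (‖v t q - v t₀ q‖ ^ 2))
            (nhdsWithin t₀ (Icc 0 T)) (nhds 0)) ∧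
        -- with a uniform bound by the `T_μ((0,T);L²)` norm of `u`
        (∀ t ∈ Icc (0:ℝ) T,
          (∫⁻ q : En n × En n, ENNReal.ofReal (‖v t q‖ ^ 2)) ^ ((1:ℝ)/2)
            ≤ ENNReal.ofReal C * ((L2mu n T μ u) ^ ((1:ℝ)/2) + (L2mu n T μ h) ^ ((1:ℝ)/2))) := by
  have hD := traceConst_pos hT hμ.1 hμ.2
  refine ⟨traceConst T μ ^ ((1 : ℝ) / 2), Real.rpow_pos_of_pos hD _,
    fun u h hum hhm hu hh huh => ?_⟩
  have hwm := measurable_comp_flow hum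
  have hgm := measurable_comp_flow hhm
  have hwE := lintegral_sliceEnergy_comp_flow (T := T) (μ := μ) hum
  have hgE := lintegral_sliceEnergy_comp_flow (T := T) (μ := μ) hhm
  have hw := integrableOnStrips_of_energy hT hμ.1 hwm (hwE.trans_lt hu)
  have hg := integrableOnStrips_of_energy hT hμ.1 hgm (hgE.trans_lt hh)
  obtain ⟨c, hcm, hc⟩ := exists_ae_eq_add_primitive hT hwm hgm hw hg
    fun η hη => huh.ae_slice hw hg hη
  have hbound := fun {t : ℝ} (ht : t ∈ Icc 0 T) =>
    lintegral_enorm_sq_le hT hμ.1 hμ.2 hwm hgm hg hc ht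
  rw [hwE, hgE] at hbound
  have hsq : ∀ z : ℂ, ENNReal.ofReal (‖z‖ ^ 2) = ‖z‖ₑ ^ 2 := fun z => by
    rw [ENNReal.ofReal_pow (norm_nonneg _), ofReal_norm]
  refine ⟨flowSolution c fun t q => h t (transportFlow n t q),
    flowSolution_ae_eq hcm hum hgm hc, fun t₀ ht₀ => ?_, fun t ht => ?_⟩
  · simp_rw [hsq]
    exact tendsto_lintegral_flowSolution_sub hμ.1 hcm hgm hg (hgE.trans_lt hh) ht₀
      ((hbound ht₀).trans_lt (ENNReal.mul_lt_top ENNReal.ofReal_lt_top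
        (ENNReal.add_lt_top.2 ⟨hu, hh⟩)))
  · simp_rw [hsq]
    rw [lintegral_enorm_sq_flowSolution hcm hgm, ← ENNReal.ofReal_rpow_of_pos hD]
    refine (ENNReal.rpow_le_rpow (hbound ht) (by norm_num)).trans ?_
    rw [ENNReal.mul_rpow_of_nonneg _ _ (by norm_num)]
    gcongr
    exact ENNReal.rpow_add_le_add_rpow _ _ (by norm_num) (by norm_num)
end
end

section
/- Let T > 0, μ ∈ (1/2,1], β ∈ (0,2] and s ≥ −1/2. Suppose u ∈ T_μ((0,T); X_β^s) ∩ L²_μ((0,T); X_β^{s+1}) satisfies the homogeneous fractional Kolmogorov equation ∂_t u + v·∇_x u = −(−Δ_v)^{β/2} u in the sense of distributions on (0,T)×ℝ^{2n}, and its time-continuous representative satisfies u(0) = 0 (equivalently, u(t) → 0 in H^{-1}(ℝ^{2n}) as t → 0). Then u = 0 almost everywhere. -/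
open MeasureTheory Set Filter
open scoped ENNReal

noncomputable section

/-- `ω_β(k,ξ) = 1 + ‖k‖^{β/(β+1)} + ‖ξ‖^β`. -/
def omegaB (n : ℕ) (β : ℝ) (k ξ : En n) : ℝ := 1 + ‖k‖ ^ (β / (β + 1)) + ‖ξ‖ ^ β

/-- Squared norm of the anisotropic Sobolev space `X_β^s`, on the Fourier side:
`w` is the Fourier transform `û(k,ξ)`. -/
def Xnorm (n : ℕ) (β s : ℝ) (w : En n → En n → ℂ) : ℝ≥0∞ :=
  ∫⁻ (k : En n), ∫⁻ (ξ : En n), ENNReal.ofReal (omegaB n β k ξ ^ (2 * s) * ‖w k ξ‖ ^ 2)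

/-- Squared norm of `L²_μ((0,T); X_β^s)`, on the Fourier side. -/
def L2X (n : ℕ) (β s T μ : ℝ) (U : ℝ → En n → En n → ℂ) : ℝ≥0∞ :=
  ∫⁻ t in Ioo 0 T, ENNReal.ofReal (t ^ (2 - 2*μ)) * Xnorm n β s (U t)

/-- The Fourier side of the kinetic transport derivative: `Ĥ = ∂_t Û − k·∇_ξ Û` in the
sense of distributions on `(0,T) × ℝ^{2n}` (a point of `ℝ^{2n}` is `q = (k,ξ)`); this is
the Fourier transform of `h = ∂_t u + v·∇ₓ u`. -/
def IsFTransportDeriv (n : ℕ) (T : ℝ) (U H : ℝ → En n → En n → ℂ) : Prop :=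
  ∀ φ : ℝ × (En n × En n) → ℝ, ContDiff ℝ ((⊤ : ℕ∞) : WithTop ℕ∞) φ → HasCompactSupport φ →
    (∀ p : ℝ × (En n × En n), p.1 ∉ Ioo 0 T → φ p = 0) →
    -(∫ t in Ioo 0 T, ∫ q : En n × En n,
        U t q.1 q.2 * (fderiv ℝ φ (t, q) ((1 : ℝ), ((0 : En n), -q.1)) : ℂ))
      = ∫ t in Ioo 0 T, ∫ q : En n × En n, H t q.1 q.2 * (φ (t, q) : ℂ)

/-- Joint measurability of `U : ℝ → En n → En n → ℂ`. -/
def MeasU (n : ℕ) (U : ℝ → En n → En n → ℂ) : Prop :=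
  Measurable (fun p : ℝ × En n × En n => U p.1 p.2.1 p.2.2)

/-- Squared `H^{-1}(ℝ^{2n})` norm, on the Fourier side. -/
def Hm1 (n : ℕ) (w : En n → En n → ℂ) : ℝ≥0∞ :=
  ∫⁻ (k : En n), ∫⁻ (ξ : En n), ENNReal.ofReal ((1 + ‖k‖ ^ 2 + ‖ξ‖ ^ 2)⁻¹ * ‖w k ξ‖ ^ 2)

open scoped Topology ContDiff

theorem ae_eq_zero_of_forall_rat_integral_indicator_Iio {T : ℝ} {F : ℝ → ℂ}
    (hF : IntegrableOn F (Ioo 0 T))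
    (h : ∀ r : ℚ, ∫ t in Ioo 0 T, (Iio (r : ℝ)).indicator F t = 0) :
    ∀ᵐ t ∂(volume.restrict (Ioo 0 T)), F t = 0 := by
  set G : ℝ → ℂ := (Ioo 0 T).indicator F with hG
  have hGi : Integrable G := (integrable_indicator_iff measurableSet_Ioo).2 hF
  have hcont : Continuous fun x => ∫ t in (0:ℝ)..x, G t :=
    intervalIntegral.continuous_primitive (fun a b => hGi.intervalIntegrable) 0
  have hzero : (fun x => ∫ t in (0:ℝ)..x, G t) = fun _ => 0 := by
    refine Continuous.ext_on Rat.isDenseEmbedding_coe_real.dense hcont continuous_const ?_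
    rintro _ ⟨r, rfl⟩
    rcases le_total (r : ℝ) 0 with hr | hr
    · dsimp only
      rw [intervalIntegral.integral_symm, intervalIntegral.integral_of_le hr,
        setIntegral_eq_zero_of_forall_eq_zero, neg_zero]
      intro x hx
      exact indicator_of_notMem (fun hx' => absurd hx'.1 (not_lt.2 hx.2)) _
    · dsimp only
      rw [intervalIntegral.integral_of_le hr, ← h r, integral_Ioc_eq_integral_Ioo,
        hG, setIntegral_indicator measurableSet_Ioo, setIntegral_indicator measurableSet_Iio]
      congr 2
      ext x
      simp only [mem_inter_iff, mem_Ioo, mem_Iio]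
      tauto
  rw [ae_restrict_iff' measurableSet_Ioo]
  filter_upwards [LocallyIntegrable.ae_hasDerivAt_integral hGi.locallyIntegrable] with x hx hxT
  have h1 := hx 0
  rw [hzero] at h1
  have h2 := h1.unique (hasDerivAt_const x (0:ℂ))
  rwa [hG, indicator_of_mem hxT] at h2

theorem ae_eq_zero_of_le_mul_integral_Iio {T A : ℝ} {w : ℝ → ℝ} (hw0 : ∀ t, 0 ≤ w t)
    (hw : IntegrableOn w (Ioo 0 T))
    (h : ∀ᵐ t ∂(volume.restrict (Ioo 0 T)),
      w t ≤ A * ∫ τ in Ioo 0 T, (Iio t).indicator w τ) :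
    ∀ᵐ t ∂(volume.restrict (Ioo 0 T)), w t = 0 := by
  set G : ℝ → ℝ := (Ioo 0 T).indicator w with hG
  have hGi : Integrable G := (integrable_indicator_iff measurableSet_Ioo).2 hw
  have hG0 : ∀ t, 0 ≤ G t := fun t => indicator_nonneg (fun x _ => hw0 x) t
  set g : ℝ → ℝ := fun x => ∫ t in (0:ℝ)..x, G t with hg
  have hcont : Continuous g :=
    intervalIntegral.continuous_primitive (fun a b => hGi.intervalIntegrable) 0
  have hgeq : ∀ t, 0 ≤ t → g t = ∫ τ in Ioo 0 T, (Iio t).indicator w τ := by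
    intro t ht
    rw [hg]
    dsimp only
    rw [intervalIntegral.integral_of_le ht, integral_Ioc_eq_integral_Ioo,
        hG, setIntegral_indicator measurableSet_Ioo, setIntegral_indicator measurableSet_Iio]
    congr 2
    ext x
    simp only [mem_inter_iff, mem_Ioo, mem_Iio]
    tauto
  have hg0 : ∀ t, 0 ≤ t → 0 ≤ g t := fun t ht =>
    intervalIntegral.integral_nonneg ht (fun x _ => hG0 x)
  have hD : ∀ t, HasDerivAt (fun x => ∫ t in (0:ℝ)..x, g t) (g t) t := fun t =>
    intervalIntegral.integral_hasDerivAt_right (hcont.intervalIntegrable _ _)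
      (hcont.stronglyMeasurableAtFilter _ _) hcont.continuousAt
  have hGle : ∀ᵐ t, t ∈ Ioo 0 T → G t ≤ A * g t := by
    rw [ae_restrict_iff' measurableSet_Ioo] at h
    filter_upwards [h] with t ht htT
    rw [hgeq t htT.1.le, hG, indicator_of_mem htT]
    exact ht htT
  have hgle : ∀ t ∈ Ico 0 T, g t ≤ A * ∫ x in (0:ℝ)..t, g x := by
    intro t ht
    rw [← intervalIntegral.integral_const_mul]
    refine intervalIntegral.integral_mono_ae_restrict ht.1 hGi.intervalIntegrable
      ((hcont.const_mul A).intervalIntegrable _ _) ?_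
    rw [Filter.EventuallyLE, ae_restrict_iff' measurableSet_Icc]
    filter_upwards [hGle, (volume : Measure ℝ).ae_ne 0] with x hx hx0 hxt
    exact hx ⟨lt_of_le_of_ne hxt.1 (Ne.symm hx0), hxt.2.trans_lt ht.2⟩
  have hbound : ∀ t ∈ Icc 0 T, ‖∫ x in (0:ℝ)..t, g x‖ ≤ gronwallBound 0 A 0 (t - 0) := by
    refine norm_le_gronwallBound_of_norm_deriv_right_le
      (fun t _ => (hD t).continuousAt.continuousWithinAt)
      (fun t _ => (hD t).hasDerivWithinAt) (by simp) ?_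
    intro t ht
    rw [Real.norm_of_nonneg (hg0 t ht.1), Real.norm_of_nonneg
      (intervalIntegral.integral_nonneg ht.1 (fun x hx => hg0 x hx.1)), add_zero]
    exact hgle t ht
  filter_upwards [h, ae_restrict_mem measurableSet_Ioo] with t ht htT
  have hz : ∫ x in (0:ℝ)..t, g x = 0 := by
    have := hbound t (Ioo_subset_Icc_self htT)
    rwa [gronwallBound_ε0_δ0, norm_le_zero_iff] at this
  have h1 := hgle t (Ioo_subset_Ico_self htT)
  rw [hz, mul_zero] at h1
  rw [← hgeq t htT.1.le, le_antisymm h1 (hg0 t htT.1.le), mul_zero] at ht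
  exact le_antisymm ht (hw0 t)

theorem ae_add_primitive_eq_zero {T : ℝ} (hT : 0 < T) {m b : ℝ → ℂ}
    (hm : IntegrableOn m (Ioo 0 T)) (hb : IntegrableOn b (Ioo 0 T))
    (hweak : ∀ θ : ℝ → ℝ, ContDiff ℝ ∞ θ → (∀ t ∉ Ioo 0 T, θ t = 0) →
      ∫ t in Ioo 0 T, deriv θ t • m t = ∫ t in Ioo 0 T, θ t • b t)
    (h0 : Tendsto m (𝓝[Ioo 0 T] 0) (𝓝 0)) :
    ∀ᵐ t ∂(volume.restrict (Ioo 0 T)),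
      m t + ∫ τ in Ioo 0 T, (Iio t).indicator b τ = 0 := by
  set B : ℝ → ℂ := fun t => ∫ τ in Ioo 0 T, (Iio t).indicator b τ with hB
  have hBm : Integrable (fun p : ℝ × ℝ => (Iio p.1).indicator b p.2)
      ((volume.restrict (Ioo 0 T)).prod (volume.restrict (Ioo 0 T))) := by
    have h1 : Integrable (fun p : ℝ × ℝ => b p.2)
      ((volume.restrict (Ioo 0 T)).prod (volume.restrict (Ioo 0 T))) := hb.comp_snd _
    exact h1.indicator (measurableSet_lt measurable_snd measurable_fst)
  have hBi : IntegrableOn B (Ioo 0 T) := hBm.integral_prod_left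
  have hB0 : Tendsto B (𝓝[Ioo 0 T] 0) (𝓝 0) := by
    have : Tendsto B (𝓝[Ioo 0 T] 0) (𝓝 (∫ τ in Ioo 0 T, (0:ℂ))) := by
      refine tendsto_integral_filter_of_dominated_convergence (fun t => ‖b t‖) ?_ ?_ hb.norm ?_
      · exact Eventually.of_forall fun t => (hb.indicator measurableSet_Iio).aestronglyMeasurable
      · exact Eventually.of_forall fun t => Eventually.of_forall fun τ =>
          norm_indicator_le_norm_self _ _
      · filter_upwards [ae_restrict_mem measurableSet_Ioo] with τ hτ
        refine tendsto_const_nhds.congr' ?_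
        filter_upwards [mem_nhdsWithin_of_mem_nhds (Iio_mem_nhds hτ.1)] with t ht
        exact (indicator_of_notMem (s := Iio t) (f := b) (fun h : τ < t => absurd h (not_lt.2 (le_of_lt ht)))).symm
    simpa using this
  have hF0 : Tendsto (fun t => m t + B t) (𝓝[Ioo 0 T] 0) (𝓝 0) := by simpa using h0.add hB0
  have hFi : IntegrableOn (fun t => m t + B t) (Ioo 0 T) := hm.add hBi
  have hparts : ∀ θ : ℝ → ℝ, ContDiff ℝ ∞ θ → (∀ t ∉ Ioo 0 T, θ t = 0) →
      ∫ t in Ioo 0 T, deriv θ t • (m t + B t) = 0 := by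
    intro θ hθ hθ0
    have hd : Continuous (deriv θ) := hθ.continuous_deriv (by simp)
    obtain ⟨C, hC⟩ := (isCompact_Icc (a := (0:ℝ)) (b := T)).exists_bound_of_continuousOn
      hd.continuousOn
    have hC' : ∀ᵐ t ∂(volume.restrict (Ioo 0 T)), ‖deriv θ t‖ ≤ C := by
      filter_upwards [ae_restrict_mem measurableSet_Ioo] with t ht
      exact hC t (Ioo_subset_Icc_self ht)
    have hi1 : IntegrableOn (fun t => deriv θ t • m t) (Ioo 0 T) :=
      Integrable.bdd_smul hm C hd.aestronglyMeasurable hC'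
    have hi2 : IntegrableOn (fun t => deriv θ t • B t) (Ioo 0 T) :=
      Integrable.bdd_smul hBi C hd.aestronglyMeasurable hC'
    have hi3 : Integrable (fun p : ℝ × ℝ => deriv θ p.1 • (Iio p.1).indicator b p.2)
      ((volume.restrict (Ioo 0 T)).prod (volume.restrict (Ioo 0 T))) := by
      refine Integrable.bdd_smul hBm C (hd.comp continuous_fst).aestronglyMeasurable ?_
      exact Measure.quasiMeasurePreserving_fst.ae hC'
    have hi4 : IntegrableOn (fun t => θ t • b t) (Ioo 0 T) := by
      obtain ⟨C', hC'⟩ := (isCompact_Icc (a := (0:ℝ)) (b := T)).exists_bound_of_continuousOn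
        hθ.continuous.continuousOn
      refine Integrable.bdd_smul hb C' hθ.continuous.aestronglyMeasurable ?_
      filter_upwards [ae_restrict_mem measurableSet_Ioo] with t ht
      exact hC' t (Ioo_subset_Icc_self ht)
    simp_rw [smul_add]
    rw [integral_add hi1 hi2, hweak θ hθ hθ0]
    simp_rw [hB, ← integral_smul]
    rw [integral_integral_swap hi3, ← integral_add hi4 hi3.integral_prod_right]
    refine integral_eq_zero_of_ae ?_
    filter_upwards [ae_restrict_mem measurableSet_Ioo] with τ hτ
    have e1 : ∀ t, deriv θ t • (Iio t).indicator b τ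
        = ((Ioi τ).indicator (deriv θ) t) • b τ := by
      intro t
      by_cases h : τ < t
      · rw [indicator_of_mem (show τ ∈ Iio t from h), indicator_of_mem (show t ∈ Ioi τ from h)]
      · rw [indicator_of_notMem (show τ ∉ Iio t from h), indicator_of_notMem (show t ∉ Ioi τ from h)]
        simp
    simp_rw [e1]
    rw [integral_smul_const, setIntegral_indicator measurableSet_Ioi]
    have e2 : Ioo 0 T ∩ Ioi τ = Ioo τ T := by
      ext x
      simp only [mem_inter_iff, mem_Ioo, mem_Ioi]
      exact ⟨fun h => ⟨h.2, h.1.2⟩, fun h => ⟨⟨hτ.1.trans h.1, h.2⟩, h.1⟩⟩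
    rw [e2, ← integral_Ioc_eq_integral_Ioo, ← intervalIntegral.integral_of_le hτ.2.le,
      intervalIntegral.integral_deriv_eq_sub (fun x _ => (hθ.differentiable (by simp)) x)
        (hd.intervalIntegrable _ _), hθ0 T (by simp)]
    simp
  have key : ∀ᵐ t, t ∈ Ioo 0 T → m t + B t = 0 := by
    refine isOpen_Ioo.ae_eq_zero_of_integral_contDiff_smul_eq_zero hFi.locallyIntegrableOn ?_
    intro f hf hfc hfs
    have hf0 : ∀ t ∉ Ioo 0 T, f t = 0 := fun t ht => image_eq_zero_of_notMem_tsupport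
      (fun h => ht (hfs h))
    rw [← setIntegral_eq_integral_of_forall_compl_eq_zero (s := Ioo 0 T)
      (fun t ht => by rw [hf0 t ht, zero_smul])]
    set c : ℝ := ∫ t, f t with hc
    have hfint : Integrable f := hf.continuous.integrable_of_hasCompactSupport hfc
    have hbound : ∀ δ > 0, ‖∫ t in Ioo 0 T, f t • (m t + B t)‖ ≤ |c| * δ := by
      intro δ hδ
      have hev := hF0.eventually (Metric.closedBall_mem_nhds (0:ℂ) hδ)
      obtain ⟨ε, hε, hεF⟩ := Metric.mem_nhdsWithin_iff.1 hev
      set r : ℝ := min ε T / 2 with hr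
      have hr0 : 0 < r := half_pos (lt_min hε hT)
      have hrε : 2 * r ≤ ε := by rw [hr]; linarith [min_le_left ε T]
      have hrT : 2 * r ≤ T := by rw [hr]; linarith [min_le_right ε T]
      let ρ : ContDiffBump r := ⟨r / 2, r, half_pos hr0, half_lt_self hr0⟩
      set p : ℝ → ℝ := ρ.normed volume with hp
      have hpsupp : ∀ t, p t ≠ 0 → t ∈ Ioo 0 (2 * r) := by
        intro t ht
        have h1 : t ∈ Metric.ball r r := by
          rw [← ρ.support_normed_eq (μ := (volume : Measure ℝ))]; exact ht
        rw [Real.ball_eq_Ioo] at h1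
        exact ⟨by linarith [h1.1], by linarith [h1.2]⟩
      have hp0 : ∀ t ∉ Ioo 0 T, p t = 0 := fun t ht => by
        by_contra h
        exact ht ⟨(hpsupp t h).1, (hpsupp t h).2.trans_le hrT⟩
      have hpi : Integrable p := ρ.integrable_normed
      have hp1 : ∫ t, p t = 1 := ρ.integral_normed
      have hpc : ContDiff ℝ ∞ p := ρ.contDiff_normed (n := ⊤)
      set η : ℝ → ℝ := fun t => f t - c * p t with hη
      have hηc : ContDiff ℝ ∞ η := hf.sub (contDiff_const.mul hpc)
      have hη0 : ∀ t ∉ Ioo 0 T, η t = 0 := fun t ht => by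
        simp [hη, hf0 t ht, hp0 t ht]
      have hη1 : ∫ t, η t = 0 := by
        rw [hη, integral_sub hfint (hpi.const_mul c), integral_const_mul, hp1, ← hc]; ring
      have hD : ∀ t, HasDerivAt (fun x => ∫ t in (0:ℝ)..x, η t) (η t) t := fun t =>
        intervalIntegral.integral_hasDerivAt_right (hηc.continuous.intervalIntegrable _ _)
          (hηc.continuous.stronglyMeasurableAtFilter _ _) hηc.continuous.continuousAt
      have hDeq : deriv (fun x => ∫ t in (0:ℝ)..x, η t) = η := funext fun t => (hD t).deriv
      have h1 := hparts (fun x => ∫ t in (0:ℝ)..x, η t)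
        (contDiff_infty_iff_deriv.2 ⟨fun t => (hD t).differentiableAt, by rw [hDeq]; exact hηc⟩) (by
          intro t ht
          rcases le_or_gt t 0 with h | h
          · rw [intervalIntegral.integral_symm, intervalIntegral.integral_of_le h,
              setIntegral_eq_zero_of_forall_eq_zero, neg_zero]
            exact fun x hx => hη0 x fun hx' => absurd hx'.1 (not_lt.2 hx.2)
          · have hTt : T ≤ t := by
              by_contra h'
              exact ht ⟨h, not_le.1 h'⟩
            rw [intervalIntegral.integral_of_le h.le,
              setIntegral_eq_integral_of_forall_compl_eq_zero, hη1]
            exact fun x hx => hη0 x fun hx' => hx ⟨hx'.1, hx'.2.le.trans hTt⟩)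
      rw [hDeq] at h1
      have hbd : ∀ g : ℝ → ℝ, Continuous g →
          IntegrableOn (fun t => g t • (m t + B t)) (Ioo 0 T) := by
        intro g hg
        obtain ⟨C', hC'⟩ := (isCompact_Icc (a := (0:ℝ)) (b := T)).exists_bound_of_continuousOn
          hg.continuousOn
        refine Integrable.bdd_smul hFi C' hg.aestronglyMeasurable ?_
        filter_upwards [ae_restrict_mem measurableSet_Ioo] with t ht
        exact hC' t (Ioo_subset_Icc_self ht)
      have h2 : ∫ t in Ioo 0 T, f t • (m t + B t) = c • ∫ t in Ioo 0 T, p t • (m t + B t) := by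
        rw [← sub_eq_zero, ← integral_smul]
        refine (integral_sub (hbd f hf.continuous) ((hbd p hpc.continuous).smul c)).symm.trans ?_
        rw [← h1]
        refine integral_congr_ae (Eventually.of_forall fun t => ?_)
        simp only [hη, sub_smul, mul_smul, Pi.smul_apply]
      rw [h2, norm_smul, Real.norm_eq_abs]
      refine mul_le_mul_of_nonneg_left ?_ (abs_nonneg c)
      have h3 : ‖∫ t in Ioo 0 T, p t • (m t + B t)‖ ≤ ∫ t in Ioo 0 T, p t * δ := by
        refine norm_integral_le_of_norm_le (hpi.integrableOn.mul_const δ) ?_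
        filter_upwards [ae_restrict_mem measurableSet_Ioo] with t ht
        rw [norm_smul, Real.norm_of_nonneg (ρ.nonneg_normed t)]
        by_cases hpt : p t = 0
        · rw [← hp, hpt]; simp
        · refine mul_le_mul_of_nonneg_left ?_ (ρ.nonneg_normed t)
          have := hεF ⟨by
            rw [Metric.mem_ball, dist_zero_right, Real.norm_of_nonneg ht.1.le]
            exact (hpsupp t hpt).2.trans_le hrε, ht⟩
          simpa using this
      refine h3.trans_eq ?_
      rw [integral_mul_const, setIntegral_eq_integral_of_forall_compl_eq_zero hp0, hp1, one_mul]
    have hlim : Tendsto (fun δ : ℝ => |c| * δ) (𝓝[>] 0) (𝓝 0) := by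
      have : Tendsto (fun δ : ℝ => |c| * δ) (𝓝 0) (𝓝 (|c| * 0)) :=
        (continuous_const.mul continuous_id).tendsto 0
      rw [mul_zero] at this
      exact this.mono_left nhdsWithin_le_nhds
    exact norm_le_zero_iff.1 (ge_of_tendsto hlim (eventually_mem_nhdsWithin.mono hbound))
  rwa [ae_restrict_iff' measurableSet_Ioo]

theorem integrable_prod_smul_of_compact {E : Type*} [TopologicalSpace E]
    [SecondCountableTopology E] [MeasurableSpace E] [BorelSpace E] {lam : Measure E}
    [SFinite lam] {ν : Measure ℝ} [SFinite ν] {f : ℝ → E → ℂ}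
    (hf : ∀ K : Set E, IsCompact K →
      Integrable (fun p : ℝ × E => f p.1 p.2) (ν.prod (lam.restrict K)))
    {ψ : E → ℝ} (hψ : Continuous ψ) (hψc : HasCompactSupport ψ) :
    Integrable (fun p : ℝ × E => ψ p.2 • f p.1 p.2) (ν.prod lam) := by
  obtain ⟨C, hC⟩ := hψ.bounded_above_of_compact_support hψc
  have h1 : Integrable (fun p : ℝ × E => ψ p.2 • f p.1 p.2)
      (ν.prod (lam.restrict (tsupport ψ))) :=
    Integrable.bdd_smul (hf _ hψc) C (hψ.comp continuous_snd).aestronglyMeasurable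
      (Eventually.of_forall fun p => hC p.2)
  have h2 : ν.prod (lam.restrict (tsupport ψ))
      = (ν.prod lam).restrict (univ ×ˢ tsupport ψ) := by
    rw [← Measure.prod_restrict, Measure.restrict_univ]
  rw [h2] at h1
  refine (integrableOn_iff_integrable_of_support_subset ?_).1 h1
  intro p hp
  refine ⟨mem_univ _, subset_tsupport _ fun h => hp ?_⟩
  simp [h]

theorem ae_ae_eq_zero_of_weak_linear_ode {E : Type*} [NormedAddCommGroup E] [NormedSpace ℝ E]
    [FiniteDimensional ℝ E] [MeasurableSpace E] [BorelSpace E] {lam : Measure E} [SFinite lam]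
    [IsLocallyFiniteMeasure lam] {T : ℝ} (hT : 0 < T)
    {V : ℝ → E → ℂ} (hV : Measurable fun p : ℝ × E => V p.1 p.2)
    {a : ℝ → E → ℝ} (ha : Continuous fun p : ℝ × E => a p.1 p.2)
    (hVK : ∀ K : Set E, IsCompact K → Integrable (fun p : ℝ × E => V p.1 p.2)
      ((volume.restrict (Ioo 0 T)).prod (lam.restrict K)))
    (hweak : ∀ (θ : ℝ → ℝ) (ψ : E → ℝ), ContDiff ℝ ∞ θ → (∀ t ∉ Ioo 0 T, θ t = 0) →
      ContDiff ℝ ∞ ψ → HasCompactSupport ψ →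
      ∫ t in Ioo 0 T, deriv θ t • ∫ q, ψ q • V t q ∂lam
        = ∫ t in Ioo 0 T, θ t • ∫ q, ψ q • (a t q • V t q) ∂lam)
    (h0 : ∀ ψ : E → ℝ, ContDiff ℝ ∞ ψ → HasCompactSupport ψ →
      Tendsto (fun t => ∫ q, ψ q • V t q ∂lam) (𝓝[Ioo 0 T] 0) (𝓝 0)) :
    ∀ᵐ q ∂lam, ∀ᵐ t ∂(volume.restrict (Ioo 0 T)), V t q = 0 := by
  set ν : Measure ℝ := volume.restrict (Ioo 0 T) with hν
  set A : ℝ → E → ℂ := fun t q => a t q • V t q with hA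
  have hAm : Measurable fun p : ℝ × E => A p.1 p.2 := ha.measurable.smul hV
  have hAK : ∀ K : Set E, IsCompact K →
      Integrable (fun p : ℝ × E => A p.1 p.2) (ν.prod (lam.restrict K)) := by
    intro K hK
    obtain ⟨C, hC⟩ := ((isCompact_Icc (a := (0:ℝ)) (b := T)).prod hK).exists_bound_of_continuousOn
      ha.continuousOn
    refine Integrable.bdd_smul (hVK K hK) C ha.aestronglyMeasurable ?_
    rw [hν, Measure.prod_restrict]
    filter_upwards [ae_restrict_mem₀ (measurableSet_Ioo.prod hK.measurableSet).nullMeasurableSet]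
      with p hp
    exact hC p ⟨Ioo_subset_Icc_self hp.1, hp.2⟩
  set P : ℝ → E → ℂ := fun t q => ∫ τ, (Iio t).indicator (fun τ => A τ q) τ ∂ν with hP
  have hPm : StronglyMeasurable fun p : ℝ × E => P p.1 p.2 := by
    have h1 : Measurable fun z : (ℝ × E) × ℝ => (Iio z.1.1).indicator (fun τ => A τ z.1.2) z.2 := by
      have h2 : Measurable fun z : (ℝ × E) × ℝ => A z.2 z.1.2 :=
        hAm.comp (measurable_snd.prodMk (measurable_snd.comp measurable_fst))
      exact h2.indicator (measurableSet_lt measurable_snd (measurable_fst.comp measurable_fst))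
    exact h1.stronglyMeasurable.integral_prod_right
  have hPK : ∀ K : Set E, IsCompact K →
      Integrable (fun p : ℝ × E => P p.1 p.2) (ν.prod (lam.restrict K)) := by
    intro K hK
    have h1 : Integrable (fun p : ℝ × E => ∫ τ, ‖A τ p.2‖ ∂ν) (ν.prod (lam.restrict K)) :=
      (hAK K hK).integral_norm_prod_right.comp_snd ν
    refine h1.mono' hPm.aestronglyMeasurable ?_
    have h2 : ∀ᵐ p ∂(ν.prod (lam.restrict K)), Integrable (fun τ => A τ p.2) ν :=
      Measure.quasiMeasurePreserving_snd.ae (hAK K hK).prod_left_ae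
    filter_upwards [h2] with p hp
    exact norm_integral_le_of_norm_le hp.norm
      (Eventually.of_forall fun τ => norm_indicator_le_norm_self _ _)
  set F : ℝ → E → ℂ := fun t q => V t q + P t q with hF
  have hFK : ∀ K : Set E, IsCompact K →
      Integrable (fun p : ℝ × E => F p.1 p.2) (ν.prod (lam.restrict K)) :=
    fun K hK => (hVK K hK).add (hPK K hK)
  have hψF : ∀ ψ : E → ℝ, ContDiff ℝ ∞ ψ → HasCompactSupport ψ →
      ∀ᵐ t ∂ν, ∫ q, ψ q • F t q ∂lam = 0 := by
    intro ψ hψ hψc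
    have iV := integrable_prod_smul_of_compact hVK hψ.continuous hψc
    have iA := integrable_prod_smul_of_compact hAK hψ.continuous hψc
    have iP := integrable_prod_smul_of_compact hPK hψ.continuous hψc
    have h1 := ae_add_primitive_eq_zero hT iV.integral_prod_left iA.integral_prod_left
      (fun θ hθ hθ0 => hweak θ ψ hθ hθ0 hψ hψc) (h0 ψ hψ hψc)
    filter_upwards [h1, iV.prod_right_ae, iP.prod_right_ae] with t ht htV htP
    have h2 : ∫ q, ψ q • P t q ∂lam
        = ∫ τ, (Iio t).indicator (fun τ => ∫ q, ψ q • A τ q ∂lam) τ ∂ν := by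
      have h3 : Integrable (fun p : ℝ × E =>
          (Iio t).indicator (fun τ => ψ p.2 • A τ p.2) p.1) (ν.prod lam) :=
        iA.indicator (measurable_fst measurableSet_Iio)
      have h4 : ∀ q, ψ q • P t q = ∫ τ, (Iio t).indicator (fun τ => ψ q • A τ q) τ ∂ν := by
        intro q
        rw [hP, ← integral_smul]
        congr 1 with τ
        exact (indicator_const_smul_apply (Iio t) (ψ q) (fun τ => A τ q) τ).symm
      simp_rw [h4]
      rw [← integral_integral_swap h3]
      congr 1 with τ
      by_cases hτ : τ ∈ Iio t
      · simp only [indicator_of_mem hτ]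
      · simp only [indicator_of_notMem hτ, integral_zero]
    simp only [hF, smul_add]
    rw [integral_add htV htP, h2]
    exact ht
  have hrat : ∀ r : ℚ, ∀ᵐ q ∂lam, ∫ t, (Iio (r : ℝ)).indicator (fun t => F t q) t ∂ν = 0 := by
    intro r
    refine ae_eq_zero_of_integral_contDiff_smul_eq_zero ?_ ?_
    · rw [locallyIntegrable_iff]
      intro K hK
      exact ((hFK K hK).indicator (measurable_fst measurableSet_Iio)).integral_prod_right
    · intro ψ hψ hψc
      have iF := integrable_prod_smul_of_compact hFK hψ.continuous hψc
      have h3 : Integrable (fun p : ℝ × E =>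
          (Iio (r : ℝ)).indicator (fun τ => ψ p.2 • F τ p.2) p.1) (ν.prod lam) :=
        iF.indicator (measurable_fst measurableSet_Iio)
      have h4 : ∀ q, ψ q • ∫ t, (Iio (r : ℝ)).indicator (fun t => F t q) t ∂ν
          = ∫ τ, (Iio (r : ℝ)).indicator (fun τ => ψ q • F τ q) τ ∂ν := by
        intro q
        rw [← integral_smul]
        congr 1 with τ
        exact (indicator_const_smul_apply (Iio (r : ℝ)) (ψ q) (fun τ => F τ q) τ).symm
      simp_rw [h4]
      rw [← integral_integral_swap h3]
      refine integral_eq_zero_of_ae ?_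
      filter_upwards [hψF ψ hψ hψc] with t ht
      by_cases hτ : t ∈ Iio (r : ℝ)
      · simpa only [indicator_of_mem hτ, Pi.zero_apply] using ht
      · simp only [indicator_of_notMem hτ, integral_zero, Pi.zero_apply]
  have hloc : ∀ {f : ℝ → E → ℂ}, (∀ K : Set E, IsCompact K →
      Integrable (fun p : ℝ × E => f p.1 p.2) (ν.prod (lam.restrict K))) →
      ∀ᵐ q ∂lam, Integrable (fun t => f t q) ν := by
    intro f hf
    have h1 : ∀ N : ℕ, ∀ᵐ q ∂lam, q ∈ Metric.closedBall (0 : E) N →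
        Integrable (fun t => f t q) ν := fun N =>
      (ae_restrict_iff' Metric.isClosed_closedBall.measurableSet).1
        (hf _ (isCompact_closedBall 0 (N : ℝ))).prod_left_ae
    filter_upwards [ae_all_iff.2 h1] with q hq
    obtain ⟨N, hN⟩ := exists_nat_ge ‖q‖
    exact hq N (by simpa using hN)
  filter_upwards [ae_all_iff.2 hrat, hloc hVK, hloc hFK] with q hq hqV hqF
  have hF0 := ae_eq_zero_of_forall_rat_integral_indicator_Iio hqF hq
  obtain ⟨C, hC⟩ := (isCompact_Icc (a := (0:ℝ)) (b := T)).exists_bound_of_continuousOn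
    (f := fun t => a t q) (ha.comp (Continuous.prodMk_left q)).continuousOn
  have hgron := ae_eq_zero_of_le_mul_integral_Iio (A := C) (T := T) (w := fun t => ‖V t q‖)
    (fun t => norm_nonneg _) hqV.norm (by
      filter_upwards [hF0] with t ht
      have h1 : V t q = -P t q := eq_neg_of_add_eq_zero_left ht
      rw [h1, norm_neg, ← integral_const_mul]
      refine norm_integral_le_of_norm_le
        ((hqV.norm.indicator measurableSet_Iio).const_mul C) ?_
      filter_upwards [ae_restrict_mem measurableSet_Ioo] with τ hτ
      by_cases h : τ ∈ Iio t
      · rw [indicator_of_mem h, indicator_of_mem h, norm_smul]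
        exact mul_le_mul_of_nonneg_right (hC τ (Ioo_subset_Icc_self hτ)) (norm_nonneg _)
      · rw [indicator_of_notMem h, indicator_of_notMem h]
        simp)
  filter_upwards [hgron] with t ht
  exact norm_eq_zero.1 ht

theorem measurePreserving_shear (n : ℕ) (t : ℝ) :
    MeasurePreserving (fun q : En n × En n => (q.1, q.2 - t • q.1)) volume volume := by
  refine (MeasurePreserving.id (volume : Measure (En n))).skew_product
    (g := fun k ξ => ξ - t • k) (by fun_prop) (Eventually.of_forall fun k => ?_)
  exact (measurePreserving_sub_right volume (t • k)).map_eq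

theorem lintegral_lintegral_shear (n : ℕ) (t : ℝ) {g : En n → En n → ℝ≥0∞}
    (hg : Measurable fun q : En n × En n => g q.1 q.2) :
    ∫⁻ k, ∫⁻ ξ, g k ξ = ∫⁻ q : En n × En n, g q.1 (q.2 - t • q.1) := by
  rw [lintegral_lintegral hg.aemeasurable]
  exact ((measurePreserving_shear n t).lintegral_comp hg).symm

theorem integral_shear (n : ℕ) (t : ℝ) (g : En n × En n → ℂ) :
    ∫ q : En n × En n, g (q.1, q.2 - t • q.1) = ∫ q, g q := by
  let e : (En n × En n) ≃ₜ (En n × En n) :=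
    { toFun := fun q => (q.1, q.2 - t • q.1)
      invFun := fun q => (q.1, q.2 + t • q.1)
      left_inv := fun q => by simp
      right_inv := fun q => by simp
      continuous_toFun := by fun_prop
      continuous_invFun := by fun_prop }
  exact (measurePreserving_shear n t).integral_comp e.measurableEmbedding g

theorem integrable_of_weighted_lintegral_sq {E : Type*} [MeasurableSpace E] {lam : Measure E}
    [IsFiniteMeasure lam] {T γ : ℝ} (hγ : γ < 1) {V : ℝ → E → ℂ}
    (hV : Measurable fun p : ℝ × E => V p.1 p.2)
    (h : ∫⁻ t in Ioo 0 T, ENNReal.ofReal (t ^ γ) * ∫⁻ q, ENNReal.ofReal (‖V t q‖ ^ 2) ∂lam < ⊤) :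
    Integrable (fun p : ℝ × E => V p.1 p.2) ((volume.restrict (Ioo 0 T)).prod lam) := by
  refine ⟨hV.aestronglyMeasurable, ?_⟩
  rw [hasFiniteIntegral_iff_norm, lintegral_prod _ (by fun_prop)]
  have hfin : ∫⁻ t in Ioo 0 T, ENNReal.ofReal (t ^ (-γ)) * lam univ < ⊤ := by
    rcases le_or_gt T 0 with hT | hT
    · simp [Ioo_eq_empty (not_lt.2 hT)]
    rw [lintegral_mul_const _ (by fun_prop)]
    refine ENNReal.mul_lt_top ?_ (measure_lt_top _ _)
    have h1 : IntegrableOn (fun t : ℝ => t ^ (-γ)) (Ioo 0 T) :=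
      (intervalIntegrable_iff_integrableOn_Ioo_of_le hT.le).1
        (intervalIntegral.intervalIntegrable_rpow' (by linarith))
    exact (hasFiniteIntegral_iff_ofReal (by
      filter_upwards [ae_restrict_mem measurableSet_Ioo] with t ht
      exact Real.rpow_nonneg ht.1.le _)).1 h1.2
  have hsum := ENNReal.add_lt_top.2 ⟨h, hfin⟩
  rw [← lintegral_add_right _ (by fun_prop)] at hsum
  refine lt_of_le_of_lt (lintegral_mono_ae ?_) hsum
  filter_upwards [ae_restrict_mem measurableSet_Ioo] with t ht
  have hVt : Measurable fun q => V t q := hV.comp measurable_prodMk_left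
  rw [← lintegral_const_mul _ (by fun_prop), ← lintegral_const, ← lintegral_add_right _ (by fun_prop)]
  refine lintegral_mono fun q => ?_
  have hy : 0 < t ^ γ := Real.rpow_pos_of_pos ht.1 γ
  rw [← ENNReal.ofReal_mul hy.le, ← ENNReal.ofReal_add (by positivity)
    (Real.rpow_nonneg ht.1.le _), Real.rpow_neg ht.1.le]
  refine ENNReal.ofReal_le_ofReal ?_
  have h2 : t ^ γ * ‖V t q‖ ^ 2 + (t ^ γ)⁻¹ - ‖V t q‖
      = (t ^ γ)⁻¹ * ((t ^ γ * ‖V t q‖ - 1 / 2) ^ 2 + 3 / 4) := by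
    field_simp
    ring
  have h3 : 0 ≤ (t ^ γ)⁻¹ * ((t ^ γ * ‖V t q‖ - 1 / 2) ^ 2 + 3 / 4) := by positivity
  linarith

theorem lintegral_sq_le_Xnorm {n : ℕ} {β r : ℝ} (hr : 0 ≤ r) (w : En n → En n → ℂ) :
    ∫⁻ k, ∫⁻ ξ, ENNReal.ofReal (‖w k ξ‖ ^ 2) ≤ Xnorm n β r w := by
  refine lintegral_mono fun k => lintegral_mono fun ξ => ENNReal.ofReal_le_ofReal ?_
  refine le_mul_of_one_le_left (by positivity) (Real.one_le_rpow ?_ (by linarith))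
  have h1 : 0 ≤ ‖k‖ ^ (β / (β + 1)) := by positivity
  have h2 : 0 ≤ ‖ξ‖ ^ β := by positivity
  unfold omegaB
  linarith

theorem tendsto_integral_smul_shear {n : ℕ} {T : ℝ} {U : ℝ → En n → En n → ℂ} (hU : MeasU n U)
    (htr : Tendsto (fun t : ℝ => Hm1 n (U t)) (𝓝[Ioo 0 T] 0) (𝓝 0))
    {ψ : En n × En n → ℝ} (hψ : Continuous ψ) (hψc : HasCompactSupport ψ) :
    Tendsto (fun t => ∫ q : En n × En n, ψ q • U t q.1 (q.2 - t • q.1)) (𝓝[Ioo 0 T] 0) (𝓝 0) := by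
  obtain ⟨C, hC⟩ := hψ.bounded_above_of_compact_support hψc
  set K := tsupport ψ
  have hK : IsCompact K := hψc
  set W : ℝ × (En n × En n) → ℝ := fun p => 1 + ‖p.2.1‖ ^ 2 + ‖p.2.2 - p.1 • p.2.1‖ ^ 2 with hW
  have hWc : Continuous W := by fun_prop
  obtain ⟨D, hD⟩ := ((isCompact_Icc (a := (0:ℝ)) (b := T)).prod hK).exists_bound_of_continuousOn
    hWc.continuousOn
  have hbound : ∀ t ∈ Ioo 0 T, ‖∫ q : En n × En n, ψ q • U t q.1 (q.2 - t • q.1)‖ₑ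
      ≤ ENNReal.ofReal C * (volume K ^ (1 / 2 : ℝ)
        * (ENNReal.ofReal D * Hm1 n (U t)) ^ (1 / 2 : ℝ)) := by
    intro t ht
    have hUt : Measurable fun q : En n × En n => U t q.1 q.2 := hU.comp measurable_prodMk_left
    have hVt : Measurable fun q : En n × En n => U t q.1 (q.2 - t • q.1) :=
      hUt.comp (measurePreserving_shear n t).measurable
    have h1 : ∫⁻ q in K, ‖U t q.1 (q.2 - t • q.1)‖ₑ ^ (2 : ℝ)
        ≤ ENNReal.ofReal D * Hm1 n (U t) := by
      unfold Hm1
      rw [lintegral_lintegral_shear n t (by fun_prop), ← lintegral_const_mul _ (by fun_prop)]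
      refine le_trans ?_ (setLIntegral_le_lintegral K _)
      refine setLIntegral_mono' hK.measurableSet fun q hq => ?_
      have h2 := (le_abs_self _).trans (hD (t, q) ⟨Ioo_subset_Icc_self ht, hq⟩)
      have h3 : 0 < W (t, q) := by positivity
      rw [← ofReal_norm, ENNReal.ofReal_rpow_of_nonneg (norm_nonneg _) (by norm_num),
        ← ENNReal.ofReal_mul (h3.le.trans h2)]
      refine ENNReal.ofReal_le_ofReal ?_
      rw [← mul_assoc, Real.rpow_two]
      refine le_mul_of_one_le_left (by positivity) ?_
      rw [← div_eq_mul_inv, one_le_div h3]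
      exact h2
    have h4 : ∫⁻ q in K, ‖U t q.1 (q.2 - t • q.1)‖ₑ
        ≤ volume K ^ (1 / 2 : ℝ)
          * (∫⁻ q in K, ‖U t q.1 (q.2 - t • q.1)‖ₑ ^ (2 : ℝ)) ^ (1 / 2 : ℝ) := by
      have := ENNReal.lintegral_mul_le_Lp_mul_Lq (volume.restrict K)
        Real.HolderConjugate.two_two (f := fun _ => 1)
        (g := fun q : En n × En n => ‖U t q.1 (q.2 - t • q.1)‖ₑ)
        aemeasurable_const hVt.enorm.aemeasurable
      simpa using this
    calc ‖∫ q : En n × En n, ψ q • U t q.1 (q.2 - t • q.1)‖ₑ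
        = ‖∫ q in K, ψ q • U t q.1 (q.2 - t • q.1)‖ₑ := by
          rw [setIntegral_eq_integral_of_forall_compl_eq_zero]
          intro q hq
          rw [image_eq_zero_of_notMem_tsupport hq, zero_smul]
      _ ≤ ∫⁻ q in K, ‖ψ q • U t q.1 (q.2 - t • q.1)‖ₑ := enorm_integral_le_lintegral_enorm _
      _ ≤ ∫⁻ q in K, ENNReal.ofReal C * ‖U t q.1 (q.2 - t • q.1)‖ₑ := by
          refine lintegral_mono fun q => ?_
          rw [enorm_smul, ← ofReal_norm (ψ q)]
          gcongr
          exact hC q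
      _ = ENNReal.ofReal C * ∫⁻ q in K, ‖U t q.1 (q.2 - t • q.1)‖ₑ :=
          lintegral_const_mul _ hVt.enorm
      _ ≤ _ := by
          gcongr
          refine h4.trans ?_
          gcongr
  have hlim : Tendsto (fun t => ENNReal.ofReal C * (volume K ^ (1 / 2 : ℝ)
        * (ENNReal.ofReal D * Hm1 n (U t)) ^ (1 / 2 : ℝ))) (𝓝[Ioo 0 T] 0) (𝓝 0) := by
    have h1 := ENNReal.Tendsto.const_mul (a := ENNReal.ofReal D) htr (Or.inr ENNReal.ofReal_ne_top)
    have h2 := h1.ennrpow_const (1 / 2 : ℝ)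
    have h3 := ENNReal.Tendsto.const_mul (a := volume K ^ (1 / 2 : ℝ)) h2
      (Or.inr (ENNReal.rpow_ne_top_of_nonneg (by norm_num) hK.measure_lt_top.ne))
    have h4 := ENNReal.Tendsto.const_mul (a := ENNReal.ofReal C) h3 (Or.inr ENNReal.ofReal_ne_top)
    simpa using h4
  rw [tendsto_zero_iff_enorm_tendsto_zero]
  exact tendsto_of_tendsto_of_tendsto_of_le_of_le' tendsto_const_nhds hlim
    (Eventually.of_forall fun t => zero_le) (eventually_mem_nhdsWithin.mono hbound)

theorem weak_ode_along_characteristics {n : ℕ} {T β : ℝ} {U : ℝ → En n → En n → ℂ}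
    (heq : IsFTransportDeriv n T U (fun t k ξ => -((‖ξ‖ ^ β : ℝ) : ℂ) * U t k ξ))
    {θ : ℝ → ℝ} {ψ : En n × En n → ℝ} (hθ : ContDiff ℝ ∞ θ) (hθ0 : ∀ t ∉ Ioo 0 T, θ t = 0)
    (hψ : ContDiff ℝ ∞ ψ) (hψc : HasCompactSupport ψ) :
    ∫ t in Ioo 0 T, deriv θ t • ∫ q : En n × En n, ψ q • U t q.1 (q.2 - t • q.1)
      = ∫ t in Ioo 0 T, θ t • ∫ q : En n × En n,
          ψ q • (‖q.2 - t • q.1‖ ^ β • U t q.1 (q.2 - t • q.1)) := by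
  set φ : ℝ × (En n × En n) → ℝ := fun p => θ p.1 * ψ (p.2.1, p.2.2 + p.1 • p.2.1) with hφ
  have hφs : ContDiff ℝ ∞ φ := by
    refine (hθ.comp contDiff_fst).mul (hψ.comp ?_)
    fun_prop
  have hφc : HasCompactSupport φ := by
    have hK : IsCompact ((fun p : ℝ × (En n × En n) => (p.1, (p.2.1, p.2.2 - p.1 • p.2.1))) ''
        (Icc 0 T ×ˢ tsupport ψ)) :=
      (isCompact_Icc.prod hψc).image (by fun_prop)
    refine HasCompactSupport.intro hK fun p hp => ?_
    by_contra h
    refine hp ⟨(p.1, (p.2.1, p.2.2 + p.1 • p.2.1)), ⟨?_, ?_⟩, by simp⟩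
    · by_contra h'
      exact h (by simp only [hφ]; rw [hθ0 p.1 fun h'' => h' (Ioo_subset_Icc_self h''), zero_mul])
    · exact subset_tsupport _ fun h' => h (by simp only [hφ]; rw [h', mul_zero])
  have hφ0 : ∀ p : ℝ × (En n × En n), p.1 ∉ Ioo 0 T → φ p = 0 := fun p hp => by
    simp only [hφ, hθ0 p.1 hp, zero_mul]
  have hder : ∀ t (q : En n × En n), fderiv ℝ φ (t, q) ((1 : ℝ), ((0 : En n), -q.1))
      = deriv θ t * ψ (q.1, q.2 + t • q.1) := by
    intro t q
    have hline : HasDerivAt (fun s : ℝ => ((t + s, (q.1, q.2 - s • q.1)) : ℝ × (En n × En n)))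
        ((1 : ℝ), ((0 : En n), -q.1)) 0 := by
      refine HasDerivAt.prodMk ?_ (HasDerivAt.prodMk ?_ ?_)
      · simpa using (hasDerivAt_id (0:ℝ)).const_add t
      · exact hasDerivAt_const _ _
      · simpa using ((hasDerivAt_id (0:ℝ)).smul_const q.1).const_sub q.2
    have h1 : HasDerivAt (fun s : ℝ => φ (t + s, (q.1, q.2 - s • q.1)))
        (fderiv ℝ φ (t, q) ((1 : ℝ), ((0 : En n), -q.1))) 0 := by
      refine HasFDerivAt.comp_hasDerivAt (l := φ) (0:ℝ) ?_ hline
      simpa using ((hφs.differentiable (by simp)) (t, q)).hasFDerivAt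
    have h2 : HasDerivAt (fun s : ℝ => φ (t + s, (q.1, q.2 - s • q.1)))
        (deriv θ t * ψ (q.1, q.2 + t • q.1)) 0 := by
      have h3 : (fun s : ℝ => φ (t + s, (q.1, q.2 - s • q.1)))
          = fun s => θ (t + s) * ψ (q.1, q.2 + t • q.1) := by
        funext s
        simp only [hφ]
        congr 3
        module
      rw [h3]
      refine HasDerivAt.mul_const ?_ _
      have h4 : HasDerivAt θ (deriv θ t) (t + 0) := by
        rw [add_zero]; exact ((hθ.differentiable (by simp)) t).hasDerivAt
      exact h4.comp_const_add t 0
    exact h1.unique h2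
  have h := heq φ hφs hφc hφ0
  have hL : ∀ t, ∫ q : En n × En n,
      U t q.1 q.2 * (fderiv ℝ φ (t, q) ((1 : ℝ), ((0 : En n), -q.1)) : ℂ)
      = deriv θ t • ∫ q : En n × En n, ψ q • U t q.1 (q.2 - t • q.1) := by
    intro t
    rw [← integral_shear n t, ← integral_smul]
    refine integral_congr_ae (Eventually.of_forall fun q => ?_)
    simp only [hder, sub_add_cancel, Complex.real_smul, Complex.ofReal_mul]
    ring
  have hR : ∀ t, ∫ q : En n × En n, -((‖q.2‖ ^ β : ℝ) : ℂ) * U t q.1 q.2 * (φ (t, q) : ℂ)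
      = -(θ t • ∫ q : En n × En n,
          ψ q • (‖q.2 - t • q.1‖ ^ β • U t q.1 (q.2 - t • q.1))) := by
    intro t
    rw [← integral_shear n t, ← integral_smul, ← integral_neg]
    refine integral_congr_ae (Eventually.of_forall fun q => ?_)
    simp only [hφ, sub_add_cancel, Complex.real_smul, Complex.ofReal_mul]
    ring
  simp_rw [hL, hR] at h
  rw [integral_neg] at h
  exact neg_injective h

theorem stmt12 (n : ℕ) (hn : 1 ≤ n) (T μ β s : ℝ) (hT : 0 < T)
    (hμ : μ ∈ Ioc (1/2 : ℝ) 1) (hβ : β ∈ Ioc (0:ℝ) 2) (hs : -(1/2 : ℝ) ≤ s)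
    (U H : ℝ → En n → En n → ℂ) (hU : MeasU n U) (hH : MeasU n H)
    -- `u ∈ T_μ((0,T);X_β^s) ∩ L²_μ((0,T);X_β^{s+1})`
    (hTD : IsFTransportDeriv n T U H)
    (hUs : L2X n β s T μ U < ⊤) (hHs : L2X n β s T μ H < ⊤)
    (hUs1 : L2X n β (s + 1) T μ U < ⊤)
    -- `u` solves `∂_t u + v·∇ₓ u = −(−Δ_v)^{β/2} u` (Fourier multiplier `‖ξ‖^β`)
    (heq : IsFTransportDeriv n T U (fun t k ξ => -((‖ξ‖ ^ β : ℝ) : ℂ) * U t k ξ))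
    -- the initial value vanishes: `u(t) → 0` in `H^{-1}(ℝ^{2n})` as `t → 0⁺`
    (htr : Tendsto (fun t : ℝ => Hm1 n (U t)) (nhdsWithin 0 (Ioo 0 T)) (nhds 0)) :
    -- then `u = 0` almost everywhere
    ∀ᵐ t ∂(volume.restrict (Ioo 0 T)), ∀ᵐ (k : En n) ∂(volume : Measure (En n)),
      ∀ᵐ (ξ : En n) ∂(volume : Measure (En n)), U t k ξ = 0 := by
  have hβ0 : 0 < β := hβ.1
  set V : ℝ → En n × En n → ℂ := fun t q => U t q.1 (q.2 - t • q.1) with hV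
  have hVm : Measurable fun p : ℝ × (En n × En n) => V p.1 p.2 := by
    have h1 : Measurable fun p : ℝ × (En n × En n) => (p.1, p.2.1, p.2.2 - p.1 • p.2.1) := by
      fun_prop
    exact hU.comp h1
  have hL2 : ∫⁻ t in Ioo 0 T, ENNReal.ofReal (t ^ (2 - 2 * μ))
      * ∫⁻ q, ENNReal.ofReal (‖V t q‖ ^ 2) < ⊤ := by
    refine lt_of_le_of_lt (lintegral_mono fun t => ?_) hUs1
    have hUt : Measurable fun q : En n × En n => U t q.1 q.2 := hU.comp measurable_prodMk_left
    gcongr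
    refine le_trans ?_ (lintegral_sq_le_Xnorm (by linarith) (U t))
    rw [lintegral_lintegral_shear n t (by fun_prop)]
  have hV0 : ∀ᵐ q : En n × En n, ∀ᵐ t ∂(volume.restrict (Ioo 0 T)), V t q = 0 := by
    refine ae_ae_eq_zero_of_weak_linear_ode hT hVm (a := fun t q => ‖q.2 - t • q.1‖ ^ β)
      ?_ ?_ ?_ ?_
    · have h1 : Continuous fun p : ℝ × (En n × En n) => ‖p.2.2 - p.1 • p.2.1‖ := by fun_prop
      exact h1.rpow_const fun _ => Or.inr hβ0.le
    · intro K hK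
      have : IsFiniteMeasure ((volume : Measure (En n × En n)).restrict K) :=
        ⟨by simpa using hK.measure_lt_top⟩
      refine integrable_of_weighted_lintegral_sq (γ := 2 - 2 * μ) (by linarith [hμ.1]) hVm
        (lt_of_le_of_lt (lintegral_mono fun t => ?_) hL2)
      gcongr
      exact Measure.restrict_le_self
    · intro θ ψ hθ hθ0 hψ hψc
      exact weak_ode_along_characteristics heq hθ hθ0 hψ hψc
    · intro ψ hψ hψc
      exact tendsto_integral_smul_shear hU htr hψ.continuous hψc
  have hms : MeasurableSet {p : ℝ × (En n × En n) | V p.1 p.2 = 0} :=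
    hVm (measurableSet_singleton 0)
  have hswap : ∀ᵐ t ∂(volume.restrict (Ioo 0 T)), ∀ᵐ q : En n × En n, V t q = 0 :=
    (Measure.ae_ae_comm hms).2 hV0
  filter_upwards [hswap] with t ht
  have hUt : Measurable fun q : En n × En n => U t q.1 q.2 := hU.comp measurable_prodMk_left
  have hq : ∀ᵐ q : En n × En n, U t q.1 q.2 = 0 := by
    rw [← (measurePreserving_shear n t).map_eq]
    exact (ae_map_iff (measurePreserving_shear n t).measurable.aemeasurable
      (hUt (measurableSet_singleton 0))).2 ht
  exact Measure.ae_ae_of_ae_prod hq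
end
end
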